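/- arXiv:1206.4927 — 2 statements merged into one kernel-verified Lean document; each statement's English description precedes it below -/
import Mathlib

section
/- (Halving corollary of Theorem 3) For every optimal conditional machine U there exists a constant c ∈ ℕ such that for all strings a, b, letting n = C(a) + C(b), if C(a) ≥ c·log n, C(b) ≥ c·log n, C(a|b) ≥ c·log n, and C(b|a) ≥ c·log n, then there exists a string y such that |C(a|y) − ⌊C(a)/2⌋| ≤ c and |C(b|y) − ⌊C(b)/2⌋| ≤ c (differences in ℤ). -/
/-- A string is a finite binary string. -/
abbrev Str : Type := List Bool

/-- A conditional machine: a partial computable function mapping a pair of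
strings `(p, y)` to a string. -/
abbrev CondMachine : Type := {V : Str × Str →. Str // Partrec V}

/-- `condC V x y` is `C_V(x|y)`: the least length of a program `p` with
`V (p, y) = x`, as an element of `ℕ∞` (it is `⊤` if no such `p` exists). -/
noncomputable def condC (V : CondMachine) (x y : Str) : ℕ∞ :=
  sInf {n : ℕ∞ | ∃ p : Str, x ∈ V.1 (p, y) ∧ (p.length : ℕ∞) = n}

/-- A conditional machine `U` is optimal if for every conditional machine `V`
there is a constant `d` with `C_U(x|y) ≤ C_V(x|y) + d` for all `x, y`. -/
def OptimalMachine (U : CondMachine) : Prop :=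
  ∀ V : CondMachine, ∃ d : ℕ, ∀ x y : Str, condC U x y ≤ condC V x y + (d : ℕ∞)

/-- For an optimal machine all complexities are finite natural numbers. -/
noncomputable def KC (U : CondMachine) (x y : Str) : ℕ := (condC U x y).toNat

/-- `log2 n = Nat.log 2 (n + 2)`, so `log2 n ≥ 1`. -/
def log2 (n : ℕ) : ℕ := Nat.log 2 (n + 2)

open Encodable

section PrimrecClosure

variable {α : Type} [Primcodable α]

theorem primrecPred_exists_lt_fun {p : α → ℕ → Prop} {b : α → ℕ} (hb : Primrec b)
    (hp : PrimrecPred fun z : α × ℕ => p z.1 z.2) : PrimrecPred fun a => ∃ i < b a, p a i := by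
  have h : PrimrecRel fun (i : ℕ) (a : α) => p a i :=
    hp.comp (Primrec.pair Primrec.snd Primrec.fst)
  refine (h.exists_mem_list.comp (Primrec.list_range.comp hb) Primrec.id).of_eq fun a => ?_
  simp

theorem primrecPred_forall_lt_fun {p : α → ℕ → Prop} {b : α → ℕ} (hb : Primrec b)
    (hp : PrimrecPred fun z : α × ℕ => p z.1 z.2) : PrimrecPred fun a => ∀ i < b a, p a i := by
  have h : PrimrecRel fun (i : ℕ) (a : α) => p a i :=
    hp.comp (Primrec.pair Primrec.snd Primrec.fst)
  refine (h.forall_mem_list.comp (Primrec.list_range.comp hb) Primrec.id).of_eq fun a => ?_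
  simp

open Classical in
theorem primrec_card_filter_range {p : α → ℕ → Prop} {b : α → ℕ} (hb : Primrec b)
    (hp : PrimrecPred fun z : α × ℕ => p z.1 z.2) :
    Primrec fun a => ((Finset.range (b a)).filter (p a)).card := by
  have h : PrimrecRel fun (i : ℕ) (a : α) => p a i :=
    hp.comp (Primrec.pair Primrec.snd Primrec.fst)
  have h1 := h.listFilter.comp (Primrec.list_range.comp hb) Primrec.id
  refine (Primrec.list_length.comp h1).of_eq fun a => ?_
  simp [Finset.card, Finset.filter, Finset.range, Multiset.range]

theorem primrec_nat_pow : Primrec₂ fun m n : ℕ => m ^ n := by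
  have h : Primrec₂ fun (m n : ℕ) => Nat.rec (motive := fun _ => ℕ) 1 (fun _ r => r * m) n := by
    refine Primrec.nat_rec (g := fun (m : ℕ) (z : ℕ × ℕ) => z.2 * m) (Primrec.const 1) ?_
    exact Primrec.nat_mul.comp (Primrec.snd.comp Primrec.snd) Primrec.fst
  refine h.of_eq fun m n => ?_
  induction n with
  | zero => rfl
  | succ n ih => simp only [pow_succ, ← ih]

theorem primrec_two_pow {f : α → ℕ} (hf : Primrec f) : Primrec fun a => 2 ^ f a :=
  primrec_nat_pow.comp (Primrec.const 2) hf

end PrimrecClosure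

/-- The number with binary digits `p`, least significant digit first. -/
def strVal (p : Str) : ℕ := p.foldr (fun b r => 2 * r + cond b 1 0) 0

/-- The first `R` binary digits of `X`, least significant digit first. -/
def strOfNat (R X : ℕ) : Str := (List.range R).map fun i => decide (X / 2 ^ i % 2 = 1)

theorem strVal_cons (b : Bool) (p : Str) : strVal (b :: p) = 2 * strVal p + cond b 1 0 := rfl

theorem strOfNat_succ (R X : ℕ) :
    strOfNat (R + 1) X = decide (X % 2 = 1) :: strOfNat R (X / 2) := by
  simp [strOfNat, List.range_succ_eq_map, Nat.div_div_eq_div_mul, pow_succ', Function.comp_def]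

theorem length_strOfNat (R X : ℕ) : (strOfNat R X).length = R := by simp [strOfNat]

theorem strVal_lt (p : Str) : strVal p < 2 ^ p.length := by
  induction p with
  | nil => simp [strVal]
  | cons b p ih =>
    rw [strVal_cons, List.length_cons, pow_succ]
    cases b <;> simp <;> omega

theorem strVal_strOfNat (R X : ℕ) (h : X < 2 ^ R) : strVal (strOfNat R X) = X := by
  induction R generalizing X with
  | zero => simp [strOfNat, strVal] at *; omega
  | succ R ih =>
    rw [pow_succ] at h
    rw [strOfNat_succ, strVal_cons, ih _ (by omega)]
    by_cases hx : X % 2 = 1 <;> simp [hx] <;> omega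

theorem strOfNat_strVal (p : Str) : strOfNat p.length (strVal p) = p := by
  induction p with
  | nil => rfl
  | cons b p ih =>
    rw [List.length_cons, strOfNat_succ, strVal_cons]
    cases b
    · simp [ih]
    · simp only [cond_true]
      rw [show (2 * strVal p + 1) / 2 = strVal p by omega, ih]
      simp

theorem primrec_strVal : Primrec strVal := by
  refine Primrec.list_foldr (f := fun p : Str => p)
    (h := fun _ (z : Bool × ℕ) => 2 * z.2 + cond z.1 1 0) Primrec.id (Primrec.const 0) ?_
  refine Primrec.nat_add.comp (Primrec.nat_mul.comp (Primrec.const 2)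
    (Primrec.snd.comp Primrec.snd)) ?_
  exact (Primrec.dom_bool fun b => cond b 1 0).comp (Primrec.fst.comp Primrec.snd)

theorem primrec_strOfNat : Primrec₂ strOfNat := by
  refine Primrec.list_map (Primrec.list_range.comp Primrec.fst) ?_
  refine PrimrecPred.decide ?_
  exact Primrec.eq.comp (Primrec.nat_mod.comp (Primrec.nat_div.comp
    (Primrec.snd.comp Primrec.fst) (primrec_two_pow Primrec.snd)) (Primrec.const 2))
    (Primrec.const 1)

/-- Every conditional machine has a primitive recursive step-bounded simulation. -/
theorem exists_step_simulation (U : CondMachine) :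
    ∃ run : ℕ → Str × Str → Str → Prop,
      (PrimrecPred fun z : ℕ × (Str × Str) × Str => run z.1 z.2.1 z.2.2) ∧
      (∀ t t' a x, t ≤ t' → run t a x → run t' a x) ∧
      ∀ a x, x ∈ U.1 a ↔ ∃ t, run t a x := by
  obtain ⟨c, hc⟩ := Nat.Partrec.Code.exists_code.1 U.2
  refine ⟨fun t a x => Nat.Partrec.Code.evaln t c (encode a) = some (encode x), ?_, ?_, ?_⟩
  · refine Primrec.eq.comp (Nat.Partrec.Code.primrec_evaln.comp
      (Primrec.pair (Primrec.pair Primrec.fst (Primrec.const c))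
        (Primrec.encode.comp (Primrec.fst.comp Primrec.snd)))) ?_
    exact Primrec.option_some.comp (Primrec.encode.comp (Primrec.snd.comp Primrec.snd))
  · intro t t' a x h hx
    exact Nat.Partrec.Code.evaln_mono h hx
  · intro a x
    have h := Nat.Partrec.Code.evaln_complete (c := c) (n := encode a) (x := encode x)
    rw [hc] at h
    simpa using h

theorem condC_le_of_mem (V : CondMachine) {x y p : Str} (h : x ∈ V.1 (p, y)) :
    condC V x y ≤ p.length := sInf_le ⟨p, h, rfl⟩

theorem condC_ne_top {U : CondMachine} (hU : OptimalMachine U) (x y : Str) :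
    condC U x y ≠ ⊤ := by
  obtain ⟨d, hd⟩ := hU ⟨fun z => Part.some z.1, Computable.partrec Computable.fst⟩
  have h1 : condC ⟨fun z => Part.some z.1, Computable.partrec Computable.fst⟩ x y ≤ x.length :=
    condC_le_of_mem _ (by simp)
  refine ne_top_of_le_ne_top ?_ ((hd x y).trans (add_le_add_left h1 _))
  exact_mod_cast ENat.natCast_ne_top (x.length + d)

theorem KC_le_of_mem {U : CondMachine} {x y p : Str} (h : x ∈ U.1 (p, y)) :
    KC U x y ≤ p.length := by
  have := ENat.toNat_le_toNat (condC_le_of_mem U h) (ENat.natCast_ne_top _)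
  simpa [KC] using this

theorem exists_program {U : CondMachine} (hU : OptimalMachine U) (x y : Str) :
    ∃ p : Str, x ∈ U.1 (p, y) ∧ p.length = KC U x y := by
  have hne : {n : ℕ∞ | ∃ p : Str, x ∈ U.1 (p, y) ∧ (p.length : ℕ∞) = n}.Nonempty := by
    by_contra h
    rw [Set.not_nonempty_iff_eq_empty] at h
    apply condC_ne_top hU x y
    rw [condC, h, sInf_empty]
  obtain ⟨p, hp, hl⟩ := csInf_mem hne
  refine ⟨p, hp, ?_⟩
  rw [KC, condC, ← hl, ENat.toNat_natCast]

theorem exists_KC_le_of_machine {U : CondMachine} (hU : OptimalMachine U)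
    {V : Str × Str →. Str} (hV : Partrec V) :
    ∃ d, ∀ x y p, x ∈ V (p, y) → KC U x y ≤ p.length + d := by
  obtain ⟨d, hd⟩ := hU ⟨V, hV⟩
  refine ⟨d, fun x y p h => ?_⟩
  have h1 := (hd x y).trans (add_le_add_left (condC_le_of_mem ⟨V, hV⟩ h) _)
  have := ENat.toNat_le_toNat h1 (by exact_mod_cast ENat.natCast_ne_top (p.length + d))
  exact_mod_cast this

/-- A condition that can be computed from another one is at most as useful. -/
theorem exists_KC_le_KC_comp {U : CondMachine} (hU : OptimalMachine U) {φ : Str → Str}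
    (hφ : Computable φ) : ∃ d, ∀ x y, KC U x y ≤ KC U x (φ y) + d := by
  have hV : Partrec fun z : Str × Str => U.1 (z.1, φ z.2) :=
    U.2.comp (Computable.pair Computable.fst (hφ.comp Computable.snd))
  obtain ⟨d, hd⟩ := exists_KC_le_of_machine hU hV
  refine ⟨d, fun x y => ?_⟩
  obtain ⟨p, hp, hl⟩ := exists_program hU x (φ y)
  rw [← hl]
  exact hd x y p hp

section Enumeration

variable (P : (ℕ × (ℕ × ℕ × ℕ)) × (Str × Str) → Prop)

/-- The string examined at step `m` of the enumeration. -/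
def candidate (m : ℕ) : Str := (decode (α := Str) m.unpair.2).getD []

open Classical in
/-- One step of the enumeration: the candidate is appended if it is accepted and new. -/
noncomputable def enumStep (w : ℕ × ℕ × ℕ) (y : Str) (m : ℕ) (L : List Str) : List Str :=
  if P ((m.unpair.1, w), (y, candidate m)) ∧ ¬ ∃ a ∈ L, a = candidate m
    then L ++ [candidate m] else L

/-- The first `n` steps of the enumeration without repetitions of
the strings `x` with `P ((t, w), (y, x))` for some `t`. -/
noncomputable def enumList (w : ℕ × ℕ × ℕ) (y : Str) (n : ℕ) : List Str :=
  Nat.rec [] (fun m L => enumStep P w y m L) n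

variable {P}

theorem enumList_succ (w : ℕ × ℕ × ℕ) (y : Str) (n : ℕ) :
    enumList P w y (n + 1) = enumStep P w y n (enumList P w y n) := rfl

theorem candidate_pair (t : ℕ) (x : Str) : candidate (Nat.pair t (encode x)) = x := by
  simp [candidate]

theorem enumList_prefix {w : ℕ × ℕ × ℕ} {y : Str} {m n : ℕ} (h : m ≤ n) :
    enumList P w y m <+: enumList P w y n := by
  induction n, h using Nat.le_induction with
  | base => exact List.prefix_refl _
  | succ n _ ih =>
    refine ih.trans ?_
    rw [enumList_succ, enumStep]
    split_ifs
    · exact List.prefix_append _ _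
    · exact List.prefix_refl _

theorem enumList_sound {w : ℕ × ℕ × ℕ} {y : Str} (n : ℕ) :
    (enumList P w y n).Nodup ∧ ∀ x ∈ enumList P w y n, ∃ t, P ((t, w), (y, x)) := by
  induction n with
  | zero => simp [enumList]
  | succ n ih =>
    rw [enumList_succ, enumStep]
    split_ifs with h
    · refine ⟨ih.1.append (List.nodup_singleton _) ?_, ?_⟩
      · intro x hx hx'
        rw [List.mem_singleton] at hx'
        exact h.2 ⟨x, hx, hx'⟩
      · intro x hx
        rcases List.mem_append.1 hx with hx | hx
        · exact ih.2 x hx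
        · rw [List.mem_singleton] at hx
          exact ⟨_, hx ▸ h.1⟩
    · exact ih

theorem enumList_complete {w : ℕ × ℕ × ℕ} {y x : Str} {t : ℕ} (h : P ((t, w), (y, x))) :
    ∃ n, x ∈ enumList P w y n := by
  refine ⟨Nat.pair t (encode x) + 1, ?_⟩
  rw [enumList_succ, enumStep, candidate_pair, Nat.unpair_pair]
  split_ifs with h'
  · simp
  · by_contra hx
    exact h' ⟨h, fun ⟨a, ha, hax⟩ => hx (hax ▸ ha)⟩

theorem primrec_enumList (hP : PrimrecPred P) :
    Primrec fun z : ((ℕ × ℕ × ℕ) × Str) × ℕ => enumList P z.1.1 z.1.2 z.2 := by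
  have hx : Primrec candidate :=
    Primrec.option_getD.comp (Primrec.decode.comp (Primrec.snd.comp Primrec.unpair))
      (Primrec.const [])
  have hm : Primrec fun z : ((ℕ × ℕ × ℕ) × Str) × (ℕ × List Str) => z.2.1 :=
    Primrec.fst.comp Primrec.snd
  have hL : Primrec fun z : ((ℕ × ℕ × ℕ) × Str) × (ℕ × List Str) => z.2.2 :=
    Primrec.snd.comp Primrec.snd
  have hmem : PrimrecRel fun (L : List Str) (x : Str) => ∃ a ∈ L, a = x :=
    (Primrec.eq (α := Str)).exists_mem_list
  have h1 : PrimrecPred fun z : ((ℕ × ℕ × ℕ) × Str) × (ℕ × List Str) =>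
      P ((z.2.1.unpair.1, z.1.1), (z.1.2, candidate z.2.1)) :=
    hP.comp (Primrec.pair (Primrec.pair (Primrec.fst.comp (Primrec.unpair.comp hm))
      (Primrec.fst.comp Primrec.fst)) (Primrec.pair (Primrec.snd.comp Primrec.fst) (hx.comp hm)))
  have h2 := hmem.comp hL (hx.comp hm)
  have hstep : Primrec₂ fun (z : (ℕ × ℕ × ℕ) × Str) (v : ℕ × List Str) =>
      enumStep P z.1 z.2 v.1 v.2 := by
    classical
    refine (Primrec.ite (h1.and h2.not) (Primrec.list_concat.comp hL (hx.comp hm)) hL).of_eq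
      fun z => ?_
    unfold enumStep
    congr
  have hrec := Primrec.nat_rec (f := fun _ : (ℕ × ℕ × ℕ) × Str => ([] : List Str))
    (Primrec.const []) hstep
  have h : Primrec₂ fun (z : (ℕ × ℕ × ℕ) × Str) (n : ℕ) => enumList P z.1 z.2 n :=
    hrec.of_eq fun z n => by rw [enumList]
  exact h.comp Primrec.fst Primrec.snd

end Enumeration

/-- The program `1ʲ0s`, where `s` is `i * 2 ^ j + w` written with `e + j` digits. -/
def packProgram (j w e i : ℕ) : Str :=
  List.replicate j true ++ false :: strOfNat (e + j) (i * 2 ^ j + w)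

/-- The length of the initial block of ones. -/
def leadingOnes (p : Str) : ℕ := p.findIdx fun b => !b

/-- The digits of a packed program that follow the initial block, as a number. -/
def packedValue (p : Str) : ℕ := strVal p / 2 ^ (leadingOnes p + 1)

theorem leadingOnes_replicate_append (j : ℕ) (s : Str) :
    leadingOnes (List.replicate j true ++ false :: s) = j := by
  induction j with
  | zero => simp [leadingOnes, List.findIdx_cons]
  | succ j ih =>
    rw [leadingOnes] at ih
    rw [leadingOnes, List.replicate_succ, List.cons_append, List.findIdx_cons, ih]
    rfl

theorem leadingOnes_packProgram (j w e i : ℕ) : leadingOnes (packProgram j w e i) = j :=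
  leadingOnes_replicate_append j _

theorem strVal_replicate_append (j : ℕ) (s : Str) :
    strVal (List.replicate j true ++ false :: s) = 2 ^ (j + 1) * strVal s + (2 ^ j - 1) := by
  induction j with
  | zero => simp [strVal_cons]
  | succ j ih =>
    rw [List.replicate_succ, List.cons_append, strVal_cons, ih, cond_true]
    have : 1 ≤ 2 ^ j := Nat.one_le_two_pow
    rw [pow_succ 2 (j + 1), pow_succ 2 j]
    set A := 2 ^ j
    rw [mul_add, Nat.mul_sub]
    have h3 : 2 * (A * 2 * strVal s) = A * 2 * 2 * strVal s := by ring
    omega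

theorem packedValue_packProgram {j w e i : ℕ} (hw : w < 2 ^ j) (hi : i < 2 ^ e) :
    packedValue (packProgram j w e i) = i * 2 ^ j + w := by
  have h1 : 1 ≤ 2 ^ j := Nat.one_le_two_pow
  have h2 : i * 2 ^ j + w < 2 ^ (e + j) := by
    rw [pow_add]
    calc i * 2 ^ j + w < i * 2 ^ j + 2 ^ j := by omega
      _ = (i + 1) * 2 ^ j := by ring
      _ ≤ 2 ^ e * 2 ^ j := Nat.mul_le_mul_right _ hi
  rw [packedValue, leadingOnes_packProgram, packProgram, strVal_replicate_append,
    strVal_strOfNat _ _ h2, Nat.mul_add_div (by positivity), Nat.div_eq_of_lt, add_zero]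
  rw [pow_succ]; omega

theorem length_packProgram (j w e i : ℕ) : (packProgram j w e i).length = e + 2 * j + 1 := by
  simp [packProgram, length_strOfNat]; ring

theorem primrec_leadingOnes : Primrec leadingOnes :=
  Primrec.list_findIdx (f := fun p : Str => p) (p := fun _ b => !b) Primrec.id
    (Primrec.not.comp Primrec.snd)

theorem primrec_packedValue : Primrec packedValue :=
  Primrec.nat_div.comp primrec_strVal
    (primrec_two_pow (Primrec.succ.comp primrec_leadingOnes))

theorem pair_lt_two_pow {a b r : ℕ} (ha : a < 2 ^ r) (hb : b < 2 ^ r) :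
    Nat.pair a b < 2 ^ (2 * r) := by
  refine (Nat.pair_lt_max_add_one_sq a b).trans_le ?_
  rw [mul_comm, pow_mul]
  exact Nat.pow_le_pow_left (max_lt ha hb) 2

/-- An element of an enumerable family with at most `2 ^ e` members is determined by
its index, the parameters of the family being written with logarithmically many digits. -/
theorem exists_KC_le_of_enumerable {U : CondMachine} (hU : OptimalMachine U)
    {P : (ℕ × (ℕ × ℕ × ℕ)) × (Str × Str) → Prop} (hP : PrimrecPred P) :
    ∃ d, ∀ (w : ℕ × ℕ × ℕ) (r e : ℕ) (y x : Str), w.1 < 2 ^ r → w.2.1 < 2 ^ r → w.2.2 < 2 ^ r →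
      (∃ t, P ((t, w), (y, x))) →
      (∀ X : Finset Str, (∀ z ∈ X, ∃ t, P ((t, w), (y, z))) → X.card ≤ 2 ^ e) →
      KC U x y ≤ e + 8 * r + d := by
  let par : Str → ℕ × ℕ × ℕ := fun p =>
    ((packedValue p % 2 ^ leadingOnes p).unpair.1,
      (packedValue p % 2 ^ leadingOnes p).unpair.2.unpair)
  let idx : Str → ℕ := fun p => packedValue p / 2 ^ leadingOnes p
  have hmod : Primrec fun p => packedValue p % 2 ^ leadingOnes p :=
    Primrec.nat_mod.comp primrec_packedValue (primrec_two_pow primrec_leadingOnes)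
  have hpar : Primrec par := Primrec.pair (Primrec.fst.comp (Primrec.unpair.comp hmod))
    (Primrec.unpair.comp (Primrec.snd.comp (Primrec.unpair.comp hmod)))
  have hidx : Primrec idx :=
    Primrec.nat_div.comp primrec_packedValue (primrec_two_pow primrec_leadingOnes)
  have hstep : Primrec₂ fun (z : Str × Str) (n : ℕ) => (enumList P (par z.1) z.2 n)[idx z.1]? := by
    refine Primrec.list_getElem?.comp ((primrec_enumList hP).comp
      (Primrec.pair (Primrec.pair (hpar.comp (Primrec.fst.comp Primrec.fst))
        (Primrec.snd.comp Primrec.fst)) Primrec.snd)) (hidx.comp (Primrec.fst.comp Primrec.fst))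
  obtain ⟨d, hd⟩ := exists_KC_le_of_machine hU (Partrec.rfindOpt hstep.to_comp)
  refine ⟨d + 1, fun w r e y x h1 h2 h3 ⟨t, ht⟩ hX => ?_⟩
  obtain ⟨n, hn⟩ := enumList_complete ht
  obtain ⟨i, hi, hix⟩ := List.mem_iff_getElem.1 hn
  have hlen : (enumList P w y n).length ≤ 2 ^ e := by
    rw [← List.toFinset_card_of_nodup (enumList_sound n).1]
    exact hX _ fun z hz => (enumList_sound n).2 z (List.mem_toFinset.1 hz)
  have hw : Nat.pair w.1 (Nat.pair w.2.1 w.2.2) < 2 ^ (4 * r) := by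
    have h23 := pair_lt_two_pow h2 h3
    have h1' : w.1 < 2 ^ (2 * r) := h1.trans_le (Nat.pow_le_pow_right two_pos (by omega))
    have := pair_lt_two_pow h1' h23
    rwa [show 2 * (2 * r) = 4 * r by ring] at this
  have hval := packedValue_packProgram hw (hi.trans_le hlen)
  have hpw : par (packProgram (4 * r) (Nat.pair w.1 (Nat.pair w.2.1 w.2.2)) e i) = w := by
    simp only [par, hval, leadingOnes_packProgram, Nat.mul_add_mod_self_right,
      Nat.mod_eq_of_lt hw, Nat.unpair_pair]
  have hpi : idx (packProgram (4 * r) (Nat.pair w.1 (Nat.pair w.2.1 w.2.2)) e i) = i := by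
    simp only [idx, hval, leadingOnes_packProgram]
    rw [mul_comm, Nat.mul_add_div (by positivity), Nat.div_eq_of_lt hw, add_zero]
  have := hd x y (packProgram (4 * r) (Nat.pair w.1 (Nat.pair w.2.1 w.2.2)) e i) ?_
  · rw [length_packProgram] at this
    omega
  · simp only [hpw, hpi]
    rw [Nat.rfindOpt_mono]
    · exact ⟨n, by simp [hi, hix]⟩
    · intro a m n hmn ha
      obtain ⟨u, hu⟩ := enumList_prefix (P := P) (w := w) (y := y) hmn
      rw [← hu]
      obtain ⟨hi, -⟩ := List.getElem?_eq_some_iff.1 ha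
      rwa [List.getElem?_append_left hi]

section Lines

variable {q : ℕ} [Fact q.Prime]

/-- The lines `P = x + α s` in the plane over `ZMod q`, given by pairs `(x, α)`, that meet `W`. -/
def linesMeeting (W : Finset (ZMod q × ZMod q)) : Finset (ZMod q × ZMod q) :=
  Finset.univ.filter fun z => ∃ w ∈ W, z.1 + z.2 * w.1 = w.2

theorem card_linesMeeting_singleton (w : ZMod q × ZMod q) : (linesMeeting {w}).card = q := by
  have : linesMeeting {w} = (Finset.univ : Finset (ZMod q)).image fun α => (w.2 - α * w.1, α) := by
    ext ⟨x, α⟩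
    simp only [linesMeeting, Finset.mem_filter, Finset.mem_univ, true_and, Finset.mem_singleton,
      exists_eq_left, Finset.mem_image, Prod.mk.injEq]
    constructor
    · intro h
      exact ⟨α, by rw [← h]; ring, rfl⟩
    · rintro ⟨_, h, rfl⟩
      rw [← h]; ring
  rw [this, Finset.card_image_of_injective _ fun α β h => (Prod.mk.inj h).2, Finset.card_univ,
    ZMod.card]

theorem card_linesMeeting_inter_le_one {w w' : ZMod q × ZMod q} (h : w ≠ w') :
    (linesMeeting {w} ∩ linesMeeting {w'}).card ≤ 1 := by
  rw [Finset.card_le_one]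
  rintro ⟨x, α⟩ hz ⟨x', α'⟩ hz'
  simp only [linesMeeting, Finset.mem_inter, Finset.mem_filter, Finset.mem_univ, true_and,
    Finset.mem_singleton, exists_eq_left] at hz hz'
  have hs : w.1 - w'.1 ≠ 0 := by
    intro hs
    have hs' : w.1 = w'.1 := sub_eq_zero.1 hs
    refine h (Prod.ext hs' ?_)
    rw [← hz.1, ← hz.2, hs']
  have hα : α = α' := by
    have : (α - α') * (w.1 - w'.1) = 0 := by
      linear_combination hz.1 - hz.2 - hz'.1 + hz'.2
    rcases mul_eq_zero.1 this with h0 | h0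
    · exact sub_eq_zero.1 h0
    · exact absurd h0 hs
  subst hα
  refine Prod.ext ?_ rfl
  linear_combination hz.1 - hz'.1

theorem card_mul_le_card_linesMeeting (W : Finset (ZMod q × ZMod q)) :
    W.card * q ≤ (linesMeeting W).card + W.card * W.card := by
  classical
  induction W using Finset.induction_on with
  | empty => simp
  | insert w W hw ih =>
    have h1 : linesMeeting (insert w W) = linesMeeting {w} ∪ linesMeeting W := by
      ext z
      simp [linesMeeting]
    have h2 : (linesMeeting {w} ∩ linesMeeting W).card ≤ W.card := by
      have : linesMeeting {w} ∩ linesMeeting W ⊆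
          W.biUnion fun w' => linesMeeting {w} ∩ linesMeeting {w'} := by
        intro z hz
        simp only [linesMeeting, Finset.mem_inter, Finset.mem_filter, Finset.mem_univ, true_and,
          Finset.mem_singleton, exists_eq_left, Finset.mem_biUnion] at hz ⊢
        obtain ⟨hz, w', hw', hz'⟩ := hz
        exact ⟨w', hw', hz, hz'⟩
      refine (Finset.card_le_card this).trans ((Finset.card_biUnion_le_card_mul _ _ 1
        fun w' hw' => card_linesMeeting_inter_le_one (by rintro rfl; exact hw hw')).trans ?_)
      simp
    have h3 := Finset.card_union_add_card_inter (linesMeeting {w}) (linesMeeting W)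
    rw [card_linesMeeting_singleton] at h3
    rw [Finset.card_insert_of_notMem hw, h1]
    nlinarith

end Lines

/-- The line with number `X` has value `P` at some point `s < K`. -/
def Hits (q K X P : ℕ) : Prop := ∃ s < K, (X % q + X / q * s) % q = P

open Classical in
theorem card_mul_le_card_hits {q K : ℕ} (hq : q.Prime) (hK : K ≤ q) (S : Finset ℕ)
    (hS : ∀ P ∈ S, P < q) :
    K * S.card * q ≤ ((Finset.range (q * q)).filter fun X => ∃ P ∈ S, Hits q K X P).card +
      K * S.card * (K * S.card) := by
  have : Fact q.Prime := ⟨hq⟩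
  have hcast : ∀ {m n : ℕ}, m < q → n < q → (m : ZMod q) = n → m = n := fun hm hn h => by
    rwa [ZMod.natCast_eq_natCast_iff', Nat.mod_eq_of_lt hm, Nat.mod_eq_of_lt hn] at h
  set W : Finset (ZMod q × ZMod q) :=
    (Finset.range K ×ˢ S).image fun z => ((z.1 : ZMod q), (z.2 : ZMod q)) with hW
  have hcard : W.card = K * S.card := by
    rw [hW, Finset.card_image_of_injOn, Finset.card_product, Finset.card_range]
    rintro ⟨s, P⟩ h ⟨s', P'⟩ h' he
    simp only [Finset.coe_product, Set.mem_prod, Finset.mem_coe, Finset.mem_range] at h h'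
    simp only [Prod.mk.injEq] at he ⊢
    exact ⟨hcast (h.1.trans_le hK) (h'.1.trans_le hK) he.1, hcast (hS _ h.2) (hS _ h'.2) he.2⟩
  have hle := card_mul_le_card_linesMeeting W
  rw [hcard] at hle
  refine hle.trans (Nat.add_le_add_right ?_ _)
  refine Finset.card_le_card_of_injOn (fun z => z.1.val + q * z.2.val) ?_ ?_
  · rintro ⟨x, α⟩ hz
    simp only [linesMeeting, Finset.coe_filter, Finset.mem_univ, true_and, Set.mem_ofPred_eq, hW,
      Finset.mem_image, Finset.mem_product, Finset.mem_range] at hz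
    obtain ⟨_, ⟨⟨s, P⟩, ⟨hs, hP⟩, rfl⟩, hz⟩ := hz
    have hx := ZMod.val_lt x
    have hα := ZMod.val_lt α
    simp only [Finset.coe_filter, Finset.mem_range, Set.mem_ofPred_eq]
    refine ⟨by nlinarith, P, hP, s, hs, ?_⟩
    have h1 : (x.val + q * α.val) % q = x.val := by
      rw [Nat.add_mul_mod_self_left, Nat.mod_eq_of_lt hx]
    have h2 : (x.val + q * α.val) / q = α.val := by
      rw [Nat.add_mul_div_left _ _ hq.pos, Nat.div_eq_of_lt hx, zero_add]
    rw [h1, h2]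
    refine hcast (Nat.mod_lt _ hq.pos) (hS _ hP) ?_
    rw [ZMod.natCast_mod]
    push_cast
    rw [ZMod.natCast_zmod_val, ZMod.natCast_zmod_val]
    exact hz
  · rintro ⟨x, α⟩ - ⟨x', α'⟩ - h
    have hx := ZMod.val_lt x
    have hx' := ZMod.val_lt x'
    simp only at h
    have h1 : x.val = x'.val := by
      have := congrArg (· % q) h
      simpa [Nat.add_mul_mod_self_left, Nat.mod_eq_of_lt hx, Nat.mod_eq_of_lt hx'] using this
    have h2 : α.val = α'.val := by
      rw [h1] at h
      exact Nat.eq_of_mul_eq_mul_left hq.pos (Nat.add_left_cancel h)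
    exact Prod.ext (ZMod.val_injective q h1) (ZMod.val_injective q h2)

/-- A discrete two-dimensional intermediate value theorem of Poincaré–Miranda type. -/
theorem exists_close_of_boundary {A B : ℕ} {f g : ℕ → ℕ → ℤ} {s t d : ℤ}
    (hfi : ∀ i j, i < A → |f (i + 1) j - f i j| ≤ d)
    (hfj : ∀ i j, j < B → |f i (j + 1) - f i j| ≤ d)
    (hgi : ∀ i j, i < A → |g (i + 1) j - g i j| ≤ d)
    (hgj : ∀ i j, j < B → |g i (j + 1) - g i j| ≤ d)
    (hf0 : ∀ j ≤ B, f 0 j ≤ s) (hfA : ∀ j ≤ B, s < f A j)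
    (hg0 : ∀ i ≤ A, g i 0 ≤ t) (hgB : ∀ i ≤ A, t < g i B) :
    ∃ i ≤ A, ∃ j ≤ B, |f i j - s| ≤ 2 * d ∧ |g i j - t| ≤ 2 * d := by
  classical
  by_contra! hno
  -- the indicator of an edge between `{f ≤ s, g > t}` and `{f ≤ s, g ≤ t}`
  let e : ℕ → ℕ → ℕ → ℕ → ZMod 2 := fun i j i' j' =>
    if f i j ≤ s ∧ f i' j' ≤ s ∧ ¬ (t < g i j ↔ t < g i' j') then 1 else 0
  have hsq : ∀ i j, i < A → j < B →
      e i j i (j + 1) + e i (j + 1) (i + 1) (j + 1) + e (i + 1) j (i + 1) (j + 1)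
        + e i j (i + 1) j = 0 := by
    intro i j hi hj
    have h1 := abs_le.1 (hfi i j hi)
    have h2 := abs_le.1 (hfi i (j + 1) hi)
    have h3 := abs_le.1 (hfj i j hj)
    have h4 := abs_le.1 (hfj (i + 1) j hj)
    have k1 := abs_le.1 (hgi i j hi)
    have k2 := abs_le.1 (hgi i (j + 1) hi)
    have k3 := abs_le.1 (hgj i j hj)
    have k4 := abs_le.1 (hgj (i + 1) j hj)
    have hn := hno i hi.le j hj.le
    simp only [e]
    by_cases hmix : |f i j - s| ≤ 2 * d
    · have hg := lt_abs.1 (hn hmix)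
      have g1 : t < g (i + 1) j ↔ t < g i j := by omega
      have g2 : t < g i (j + 1) ↔ t < g i j := by omega
      have g3 : t < g (i + 1) (j + 1) ↔ t < g i j := by omega
      simp [g1, g2, g3]
    · have hf := lt_abs.1 (not_le.1 hmix)
      have f1 : f (i + 1) j ≤ s ↔ f i j ≤ s := by omega
      have f2 : f i (j + 1) ≤ s ↔ f i j ≤ s := by omega
      have f3 : f (i + 1) (j + 1) ≤ s ↔ f i j ≤ s := by omega
      simp only [f1, f2, f3]
      by_cases f0 : f i j ≤ s <;> by_cases g0 : t < g i j <;> by_cases g1 : t < g (i + 1) j <;>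
        by_cases g2 : t < g i (j + 1) <;> by_cases g3 : t < g (i + 1) (j + 1) <;>
        simp [f0, g0, g1, g2, g3, CharTwo.add_self_eq_zero]
  have hcol : ∀ i ≤ A, ∑ j ∈ Finset.range B, e i j i (j + 1) =
      ∑ j ∈ Finset.range B, e 0 j 0 (j + 1) := by
    intro i hi
    induction i with
    | zero => rfl
    | succ i ih =>
      rw [← ih (by omega)]
      have hH : ∀ j ≤ B, ∑ k ∈ Finset.range j, e (i + 1) k (i + 1) (k + 1) =
          ∑ k ∈ Finset.range j, e i k i (k + 1) + e i 0 (i + 1) 0 + e i j (i + 1) j := by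
        intro j hj
        induction j with
        | zero =>
          simp [CharTwo.add_self_eq_zero]
        | succ j ihj =>
          have := hsq i j (by omega) (by omega)
          rw [Finset.sum_range_succ, Finset.sum_range_succ, ihj (by omega)]
          have h2 : (2 : ZMod 2) = 0 := rfl
          linear_combination this - (e i j i (j + 1) + e i (j + 1) (i + 1) (j + 1)) * h2
      rw [hH B le_rfl]
      have z0 : e i 0 (i + 1) 0 = 0 := by
        have := hg0 i (by omega)
        have := hg0 (i + 1) hi
        simp only [e]
        rw [if_neg]
        rintro ⟨-, -, h⟩
        exact h ⟨fun _ => by omega, fun _ => by omega⟩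
      have zB : e i B (i + 1) B = 0 := by
        have := hgB i (by omega)
        have := hgB (i + 1) hi
        simp only [e]
        rw [if_neg]
        rintro ⟨-, -, h⟩
        exact h ⟨fun _ => by omega, fun _ => by omega⟩
      rw [z0, zB, add_zero, add_zero]
  have hA : ∑ j ∈ Finset.range B, e A j A (j + 1) = 0 := by
    refine Finset.sum_eq_zero fun j hj => ?_
    have := hfA j (Finset.mem_range.1 hj).le
    exact if_neg fun h => by omega
  have h0 : ∀ j ≤ B, ∑ k ∈ Finset.range j, e 0 k 0 (k + 1) = if t < g 0 j then 1 else 0 := by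
    intro j hj
    induction j with
    | zero => simp [hg0 0 (Nat.zero_le A)]
    | succ j ih =>
      rw [Finset.sum_range_succ, ih (by omega)]
      have h1 := hf0 j (by omega)
      have h2 := hf0 (j + 1) hj
      simp only [e, h1, h2, true_and]
      by_cases h3 : t < g 0 j <;> by_cases h4 : t < g 0 (j + 1) <;>
        simp [h3, h4, CharTwo.add_self_eq_zero]
  have := hcol A le_rfl
  rw [hA, h0 B le_rfl, if_pos (hgB 0 (Nat.zero_le A))] at this
  exact zero_ne_one this

theorem primrecPred_prime : PrimrecPred Nat.Prime := by
  have h : PrimrecPred fun z : ℕ × ℕ => ¬ (z.1 % z.2 = 0 ∧ ¬ z.2 = 1) :=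
    ((Primrec.eq.comp (Primrec.nat_mod.comp Primrec.fst Primrec.snd) (Primrec.const 0)).and
      (Primrec.eq.comp Primrec.snd (Primrec.const 1)).not).not
  refine ((Primrec.nat_le.comp (Primrec.const 2) Primrec.id).and
    (primrecPred_forall_lt_fun (p := fun p m => ¬ (p % m = 0 ∧ ¬ m = 1)) Primrec.id h)).of_eq
      fun p => ?_
  simp only [id, Nat.prime_def_lt, Nat.dvd_iff_mod_eq_zero]
  grind

/-- The least prime greater than `2 ^ N`. -/
noncomputable def primeAbove (N : ℕ) : ℕ :=
  (((List.range (2 ^ (N + 1) + 1)).filter fun q => q.Prime ∧ 2 ^ N < q).head?).getD 0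

theorem primeAbove_mem (N : ℕ) : primeAbove N ∈
    (List.range (2 ^ (N + 1) + 1)).filter fun q => q.Prime ∧ 2 ^ N < q := by
  obtain ⟨p, hp, h1, h2⟩ := Nat.exists_prime_lt_and_le_two_mul (2 ^ N) (by positivity)
  have hne : ((List.range (2 ^ (N + 1) + 1)).filter fun q => q.Prime ∧ 2 ^ N < q) ≠ [] := by
    apply List.ne_nil_of_mem (a := p)
    simp [hp, h1]
    omega
  rw [primeAbove, List.head?_eq_some_head hne]
  exact List.head_mem hne

theorem prime_primeAbove (N : ℕ) : (primeAbove N).Prime := by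
  have := primeAbove_mem N
  simp only [List.mem_filter, decide_eq_true_eq] at this
  exact this.2.1

theorem two_pow_lt_primeAbove (N : ℕ) : 2 ^ N < primeAbove N := by
  have := primeAbove_mem N
  simp only [List.mem_filter, decide_eq_true_eq] at this
  exact this.2.2

theorem primeAbove_le (N : ℕ) : primeAbove N ≤ 2 ^ (N + 1) := by
  have := primeAbove_mem N
  simp only [List.mem_filter, List.mem_range] at this
  omega

theorem primrec_primeAbove : Primrec primeAbove := by
  have h : PrimrecRel fun (q N : ℕ) => q.Prime ∧ 2 ^ N < q :=
    (primrecPred_prime.comp Primrec.fst).and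
      (Primrec.nat_lt.comp (primrec_two_pow Primrec.snd) Primrec.fst)
  have h1 := h.listFilter.comp (Primrec.list_range.comp
    (Primrec.succ.comp (primrec_two_pow Primrec.succ))) Primrec.id
  exact Primrec.option_getD.comp (Primrec.list_head?.comp h1) (Primrec.const 0)

/-- The string with number `X` among the descriptions of lines over the field
with `primeAbove N` elements. -/
def lineStr (N X : ℕ) : Str := strOfNat (2 * N + 2) X

theorem strVal_lineStr {N X : ℕ} (hX : X < primeAbove N * primeAbove N) :
    strVal (lineStr N X) = X := by
  refine strVal_strOfNat _ _ (hX.trans_le ?_)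
  have := Nat.mul_le_mul (primeAbove_le N) (primeAbove_le N)
  rwa [← pow_add, show N + 1 + (N + 1) = 2 * N + 2 by ring] at this

theorem primrec_lineStr : Primrec₂ lineStr :=
  primrec_strOfNat.comp (Primrec.nat_add.comp (Primrec.nat_mul.comp (Primrec.const 2)
    Primrec.fst) (Primrec.const 2)) Primrec.snd

theorem primrecPred_hits :
    PrimrecPred fun z : (ℕ × ℕ) × (ℕ × ℕ) => Hits z.1.1 z.1.2 z.2.1 z.2.2 := by
  refine primrecPred_exists_lt_fun (Primrec.snd.comp Primrec.fst) ?_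
  have hq : Primrec fun z : ((ℕ × ℕ) × (ℕ × ℕ)) × ℕ => z.1.1.1 :=
    Primrec.fst.comp (Primrec.fst.comp Primrec.fst)
  have hX : Primrec fun z : ((ℕ × ℕ) × (ℕ × ℕ)) × ℕ => z.1.2.1 :=
    Primrec.fst.comp (Primrec.snd.comp Primrec.fst)
  exact Primrec.eq.comp (Primrec.nat_mod.comp (Primrec.nat_add.comp (Primrec.nat_mod.comp hX hq)
    (Primrec.nat_mul.comp (Primrec.nat_div.comp hX hq) Primrec.snd)) hq)
    (Primrec.snd.comp (Primrec.snd.comp Primrec.fst))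

theorem card_le_of_KC_le {U : CondMachine} (hU : OptimalMachine U) {k : ℕ} {y : Str}
    (X : Finset Str) (hX : ∀ x ∈ X, KC U x y ≤ k) : X.card ≤ 2 ^ (k + 1) := by
  choose p hp hl using fun x => exists_program hU x y
  have hle : X.card ≤ ((Finset.range (k + 1)).sigma fun j => Finset.range (2 ^ j)).card := by
    refine Finset.card_le_card_of_injOn (fun x => ⟨(p x).length, strVal (p x)⟩) ?_ ?_
    · intro x hx
      have := hX x hx
      simp only [Finset.coe_sigma, Set.mem_sigma_iff, Finset.mem_coe, Finset.mem_range]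
      exact ⟨by rw [hl]; omega, strVal_lt _⟩
    · intro x _ x' _ h
      simp only [Sigma.mk.injEq, heq_eq_eq] at h
      have : p x = p x' := by
        rw [← strOfNat_strVal (p x), ← strOfNat_strVal (p x'), h.1, h.2]
      exact Part.mem_unique (hp x) (this ▸ hp x')
  rw [Finset.card_sigma] at hle
  simp only [Finset.card_range] at hle
  exact hle.trans (Nat.geomSum_lt le_rfl (by simp)).le

/-- Upper bounds on complexity have a primitive recursive, monotone witness relation. -/
theorem exists_stage {U : CondMachine} (hU : OptimalMachine U) :
    ∃ B : ℕ → ℕ → Str → Str → Prop,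
      (PrimrecPred fun z : (ℕ × ℕ) × (Str × Str) => B z.1.1 z.1.2 z.2.1 z.2.2) ∧
      (∀ t t' k x y, t ≤ t' → B t k x y → B t' k x y) ∧
      ∀ k x y, KC U x y ≤ k ↔ ∃ t, B t k x y := by
  obtain ⟨run, hrun, hmono, hmem⟩ := exists_step_simulation U
  refine ⟨fun t k x y => ∃ j < k + 1, ∃ i < 2 ^ j, run t (strOfNat j i, y) x, ?_, ?_, ?_⟩
  · refine primrecPred_exists_lt_fun (Primrec.succ.comp (Primrec.snd.comp Primrec.fst)) ?_
    refine primrecPred_exists_lt_fun (primrec_two_pow Primrec.snd) ?_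
    refine hrun.comp (Primrec.pair ?_ (Primrec.pair (Primrec.pair
      (primrec_strOfNat.comp (Primrec.snd.comp Primrec.fst) Primrec.snd) ?_) ?_))
    · exact Primrec.fst.comp (Primrec.fst.comp (Primrec.fst.comp Primrec.fst))
    · exact Primrec.snd.comp (Primrec.snd.comp (Primrec.fst.comp Primrec.fst))
    · exact Primrec.fst.comp (Primrec.snd.comp (Primrec.fst.comp Primrec.fst))
  · rintro t t' k x y h ⟨j, hj, i, hi, hr⟩
    exact ⟨j, hj, i, hi, hmono _ _ _ _ h hr⟩
  · intro k x y
    constructor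
    · intro h
      obtain ⟨p, hp, hl⟩ := exists_program hU x y
      obtain ⟨t, ht⟩ := (hmem _ _).1 hp
      refine ⟨t, p.length, by omega, strVal p, strVal_lt p, ?_⟩
      rwa [strOfNat_strVal]
    · rintro ⟨t, j, hj, i, hi, hr⟩
      have := KC_le_of_mem ((hmem _ _).2 ⟨t, hr⟩)
      rw [length_strOfNat] at this
      omega

theorem exists_uniform_stage {R : ℕ → ℕ → Prop} (hR : ∀ t t' i, t ≤ t' → R t i → R t' i)
    (X : Finset ℕ) (hX : ∀ i ∈ X, ∃ t, R t i) : ∃ t, ∀ i ∈ X, R t i := by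
  choose! τ hτ using hX
  exact ⟨X.sup τ, fun i hi => hR _ _ i (Finset.le_sup hi) (hτ i hi)⟩

/-- A string is determined by a line hitting its program and the abscissa of the hit. -/
theorem exists_KC_lineStr_le {U : CondMachine} (hU : OptimalMachine U) :
    ∃ d, ∀ (N l r X : ℕ) (a p : Str), N < 2 ^ r → l < 2 ^ r →
    p.length = N → a ∈ U.1 (p, []) → X < primeAbove N * primeAbove N →
    Hits (primeAbove N) (2 ^ l) X (strVal p) → KC U a (lineStr N X) ≤ l + 8 * r + d := by
  obtain ⟨run, hrun, -, hmem⟩ := exists_step_simulation U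
  let point : ℕ → Str → ℕ → Str := fun N y s =>
    strOfNat N ((strVal y % primeAbove N + strVal y / primeAbove N * s) % primeAbove N)
  have hpoint : Primrec fun z : (ℕ × Str) × ℕ => point z.1.1 z.1.2 z.2 := by
    have hN : Primrec fun z : (ℕ × Str) × ℕ => z.1.1 := Primrec.fst.comp Primrec.fst
    have hq : Primrec fun z : (ℕ × Str) × ℕ => primeAbove z.1.1 := primrec_primeAbove.comp hN
    have hX : Primrec fun z : (ℕ × Str) × ℕ => strVal z.1.2 :=
      primrec_strVal.comp (Primrec.snd.comp Primrec.fst)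
    exact primrec_strOfNat.comp hN (Primrec.nat_mod.comp (Primrec.nat_add.comp
      (Primrec.nat_mod.comp hX hq) (Primrec.nat_mul.comp (Primrec.nat_div.comp hX hq)
      Primrec.snd)) hq)
  have hP : PrimrecPred fun z : (ℕ × (ℕ × ℕ × ℕ)) × (Str × Str) =>
      ∃ s < 2 ^ z.1.2.2.1, run z.1.1 (point z.1.2.1 z.2.1 s, []) z.2.2 := by
    refine primrecPred_exists_lt_fun (primrec_two_pow (Primrec.fst.comp (Primrec.snd.comp
      (Primrec.snd.comp Primrec.fst)))) ?_
    refine hrun.comp (Primrec.pair (Primrec.fst.comp (Primrec.fst.comp Primrec.fst))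
      (Primrec.pair (Primrec.pair (hpoint.comp (Primrec.pair (Primrec.pair ?_ ?_) Primrec.snd))
        (Primrec.const [])) (Primrec.snd.comp (Primrec.snd.comp Primrec.fst))))
    · exact Primrec.fst.comp (Primrec.snd.comp (Primrec.fst.comp Primrec.fst))
    · exact Primrec.fst.comp (Primrec.snd.comp Primrec.fst)
  obtain ⟨d, hd⟩ := exists_KC_le_of_enumerable hU hP
  refine ⟨d, fun N l r X a p hN hl hlen hp hX ⟨s, hs, hsX⟩ => ?_⟩
  refine hd (N, l, 0) r l (lineStr N X) a hN hl (by positivity) ?_ ?_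
  · obtain ⟨t, ht⟩ := (hmem _ _).1 hp
    refine ⟨t, s, hs, ?_⟩
    subst hlen
    simp only [point, strVal_lineStr hX, hsX, strOfNat_strVal]
    exact ht
  · intro Z hZ
    choose! t σ hσ hr using hZ
    refine (Finset.card_le_card_of_injOn (t := Finset.range (2 ^ l)) σ
      (fun z hz => by simpa using hσ z hz) fun z hz z' hz' h => ?_).trans (by simp)
    refine Part.mem_unique ((hmem _ _).2 ⟨_, hr z hz⟩) ((hmem _ _).2 ⟨t z', ?_⟩)
    rw [h]
    exact hr z' hz'

/-- If `b` is simple relative to all lines that hit the program of `a`, then `a` is one of the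
few strings with this property. -/
theorem exists_KC_le_of_forall_hits {U : CondMachine} (hU : OptimalMachine U) :
    ∃ d, ∀ (N l k r e : ℕ) (a b p : Str), N < 2 ^ r →
    l < 2 ^ r → k < 2 ^ r → p.length = N → a ∈ U.1 (p, []) →
    (∀ X < primeAbove N * primeAbove N, Hits (primeAbove N) (2 ^ l) X (strVal p) →
      KC U b (lineStr N X) ≤ k) →
    (∀ S : Finset ℕ, (∀ P ∈ S, P < 2 ^ N ∧ ∀ X < primeAbove N * primeAbove N,
      Hits (primeAbove N) (2 ^ l) X P → KC U b (lineStr N X) ≤ k) → S.card ≤ 2 ^ e) →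
    KC U a b ≤ e + 8 * r + d := by
  obtain ⟨run, hrun, hrunmono, hmem⟩ := exists_step_simulation U
  obtain ⟨B, hB, hBmono, hBmem⟩ := exists_stage hU
  have hP : PrimrecPred fun z : (ℕ × (ℕ × ℕ × ℕ)) × (Str × Str) =>
      ∃ P < 2 ^ z.1.2.1, run z.1.1 (strOfNat z.1.2.1 P, []) z.2.2 ∧
        ∀ X < primeAbove z.1.2.1 * primeAbove z.1.2.1,
          ¬ (Hits (primeAbove z.1.2.1) (2 ^ z.1.2.2.1) X P ∧
            ¬ B z.1.1 z.1.2.2.2 z.2.1 (lineStr z.1.2.1 X)) := by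
    have hN : Primrec fun z : (ℕ × (ℕ × ℕ × ℕ)) × (Str × Str) => z.1.2.1 :=
      Primrec.fst.comp (Primrec.snd.comp Primrec.fst)
    have hq := primrec_primeAbove.comp hN
    refine primrecPred_exists_lt_fun (primrec_two_pow hN) (PrimrecPred.and ?_ ?_)
    · exact hrun.comp (Primrec.pair (Primrec.fst.comp (Primrec.fst.comp Primrec.fst))
        (Primrec.pair (Primrec.pair (primrec_strOfNat.comp (hN.comp Primrec.fst) Primrec.snd)
          (Primrec.const [])) (Primrec.snd.comp (Primrec.snd.comp Primrec.fst))))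
    · refine primrecPred_forall_lt_fun ((Primrec.nat_mul.comp hq hq).comp Primrec.fst)
        (PrimrecPred.not (PrimrecPred.and ?_ (PrimrecPred.not ?_)))
      · refine primrecPred_hits.comp (Primrec.pair (Primrec.pair
          (hq.comp (Primrec.fst.comp Primrec.fst)) (primrec_two_pow ?_))
          (Primrec.pair Primrec.snd (Primrec.snd.comp Primrec.fst)))
        exact Primrec.fst.comp (Primrec.snd.comp (Primrec.snd.comp
          (Primrec.fst.comp (Primrec.fst.comp Primrec.fst))))
      · refine hB.comp (Primrec.pair (Primrec.pair ?_ ?_) (Primrec.pair ?_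
          (primrec_lineStr.comp (hN.comp (Primrec.fst.comp Primrec.fst)) Primrec.snd)))
        · exact Primrec.fst.comp (Primrec.fst.comp (Primrec.fst.comp Primrec.fst))
        · exact Primrec.snd.comp (Primrec.snd.comp (Primrec.snd.comp
            (Primrec.fst.comp (Primrec.fst.comp Primrec.fst))))
        · exact Primrec.fst.comp (Primrec.snd.comp (Primrec.fst.comp Primrec.fst))
  obtain ⟨d, hd⟩ := exists_KC_le_of_enumerable hU hP
  refine ⟨d, fun N l k r e a b p hN hl hk hlen hp hX hS => ?_⟩
  refine hd (N, l, k) r e b a hN hl hk ?_ ?_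
  · classical
    obtain ⟨t, ht⟩ := (hmem _ _).1 hp
    obtain ⟨t', ht'⟩ := exists_uniform_stage
      (R := fun t X => B t k b (lineStr N X)) (fun t t' X h => hBmono t t' k b _ h)
      ((Finset.range (primeAbove N * primeAbove N)).filter fun X =>
        Hits (primeAbove N) (2 ^ l) X (strVal p)) fun X h => by
          rw [Finset.mem_filter, Finset.mem_range] at h
          exact (hBmem _ _ _).1 (hX X h.1 h.2)
    refine ⟨max t t', strVal p, hlen ▸ strVal_lt p, ?_, ?_⟩
    · simp only [← hlen, strOfNat_strVal]
      exact hrunmono _ _ _ _ (le_max_left _ _) ht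
    · rintro X hX ⟨h1, h2⟩
      exact h2 (hBmono _ _ _ _ _ (le_max_right _ _)
        (ht' X (Finset.mem_filter.2 ⟨Finset.mem_range.2 hX, h1⟩)))
  · intro Z hZ
    choose! t σ hσ hr hh using hZ
    simp only at hσ hr hh
    have hinj : Set.InjOn σ Z := fun z hz z' hz' h => by
      refine Part.mem_unique ((hmem _ _).2 ⟨_, hr z hz⟩) ((hmem _ _).2 ⟨t z', ?_⟩)
      rw [h]
      exact hr z' hz'
    rw [← Finset.card_image_of_injOn hinj]
    refine hS _ fun P hP => ?_
    obtain ⟨z, hz, rfl⟩ := Finset.mem_image.1 hP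
    refine ⟨hσ z hz, fun X hX hXP => (hBmem _ _ _).2 ⟨t z, ?_⟩⟩
    by_contra hb
    exact hh z hz X hX ⟨hXP, hb⟩

open Classical in
/-- A string that is simple relative to many lines is simple. -/
theorem exists_KC_le_of_card_lines {U : CondMachine} (hU : OptimalMachine U) :
    ∃ d, ∀ (N k g r : ℕ) (b : Str), N < 2 ^ r → k < 2 ^ r →
    g < 2 ^ r → g ≤ k + N + 3 →
    2 ^ g * primeAbove N ≤ 2 * ((Finset.range (primeAbove N * primeAbove N)).filter
      fun X => KC U b (lineStr N X) ≤ k).card →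
    KC U b [] ≤ k + N + 3 - g + 8 * r + d := by
  obtain ⟨B, hB, hBmono, hBmem⟩ := exists_stage hU
  have hP : PrimrecPred fun z : (ℕ × (ℕ × ℕ × ℕ)) × (Str × Str) =>
      2 ^ z.1.2.2.2 * primeAbove z.1.2.1 ≤
        2 * ((Finset.range (primeAbove z.1.2.1 * primeAbove z.1.2.1)).filter
          fun X => B z.1.1 z.1.2.2.1 z.2.2 (lineStr z.1.2.1 X)).card := by
    have hN : Primrec fun z : (ℕ × (ℕ × ℕ × ℕ)) × (Str × Str) => z.1.2.1 :=
      Primrec.fst.comp (Primrec.snd.comp Primrec.fst)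
    have hq := primrec_primeAbove.comp hN
    refine Primrec.nat_le.comp (Primrec.nat_mul.comp (primrec_two_pow (Primrec.snd.comp
      (Primrec.snd.comp (Primrec.snd.comp Primrec.fst)))) hq) (Primrec.nat_mul.comp
      (Primrec.const 2) (primrec_card_filter_range (Primrec.nat_mul.comp hq hq) ?_))
    refine hB.comp (Primrec.pair (Primrec.pair ?_ ?_) (Primrec.pair ?_
      (primrec_lineStr.comp (hN.comp Primrec.fst) Primrec.snd)))
    · exact Primrec.fst.comp (Primrec.fst.comp Primrec.fst)
    · exact Primrec.fst.comp (Primrec.snd.comp (Primrec.snd.comp (Primrec.fst.comp Primrec.fst)))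
    · exact Primrec.snd.comp (Primrec.snd.comp Primrec.fst)
  obtain ⟨d, hd⟩ := exists_KC_le_of_enumerable hU hP
  refine ⟨d, fun N k g r b hN hk hg hgk hb => ?_⟩
  refine hd (N, k, g) r (k + N + 3 - g) [] b hN hk hg ?_ ?_
  · obtain ⟨t, ht⟩ := exists_uniform_stage
      (R := fun t X => B t k b (lineStr N X)) (fun t t' X h => hBmono t t' k b _ h)
      ((Finset.range (primeAbove N * primeAbove N)).filter fun X => KC U b (lineStr N X) ≤ k)
      fun X h => (hBmem _ _ _).1 (Finset.mem_filter.1 h).2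
    refine ⟨t, hb.trans (Nat.mul_le_mul_left _ (Finset.card_le_card fun X hX => ?_))⟩
    exact Finset.mem_filter.2 ⟨(Finset.mem_filter.1 hX).1, ht X hX⟩
  · intro Z hZ
    have hZ' : ∀ z ∈ Z, 2 ^ g * primeAbove N ≤
        2 * ((Finset.range (primeAbove N * primeAbove N)).filter
          fun X => KC U z (lineStr N X) ≤ k).card := by
      intro z hz
      obtain ⟨t, ht⟩ := hZ z hz
      refine ht.trans (Nat.mul_le_mul_left _ (Finset.card_le_card fun X hX => ?_))
      rw [Finset.mem_filter] at hX ⊢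
      exact ⟨hX.1, (hBmem _ _ _).2 ⟨t, hX.2⟩⟩
    have h1 : Z.card * (2 ^ g * primeAbove N) ≤
        2 * (primeAbove N * primeAbove N * 2 ^ (k + 1)) := by
      rw [← smul_eq_mul]
      refine (Finset.card_nsmul_le_sum Z _ _ hZ').trans ?_
      rw [← Finset.mul_sum]
      refine Nat.mul_le_mul_left _ ?_
      simp only [Finset.card_filter]
      rw [Finset.sum_comm]
      simp only [← Finset.card_filter]
      refine (Finset.sum_le_card_nsmul _ _ (2 ^ (k + 1)) fun X _ => ?_).trans (by simp)
      exact card_le_of_KC_le hU _ fun x hx => (Finset.mem_filter.1 hx).2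
    have hq := (prime_primeAbove N).pos
    have h2 : Z.card * 2 ^ g ≤ 2 ^ (k + N + 3 - g) * 2 ^ g := by
      refine Nat.le_of_mul_le_mul_right ?_ hq
      calc Z.card * 2 ^ g * primeAbove N ≤ 2 * (primeAbove N * primeAbove N * 2 ^ (k + 1)) := by
            rw [mul_assoc]; exact h1
        _ ≤ 2 * (2 ^ (N + 1) * primeAbove N * 2 ^ (k + 1)) := by
            gcongr; exact primeAbove_le N
        _ = 2 ^ (k + N + 3 - g) * 2 ^ g * primeAbove N := by
            rw [← pow_add, Nat.sub_add_cancel hgk]; ring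
    exact Nat.le_of_mul_le_mul_right h2 (by positivity)

/-- The easy half of the chain rule. -/
theorem exists_KC_le_KC_add_KC {U : CondMachine} (hU : OptimalMachine U) :
    ∃ d, ∀ (r : ℕ) (a b : Str), KC U b [] < 2 ^ r →
    KC U a b < 2 ^ r → KC U a [] ≤ KC U b [] + KC U a b + 2 + 8 * r + d := by
  obtain ⟨B, hB, hBmono, hBmem⟩ := exists_stage hU
  have hP : PrimrecPred fun z : (ℕ × (ℕ × ℕ × ℕ)) × (Str × Str) =>
      ∃ m < z.1.1, B z.1.1 z.1.2.1 ((decode (α := Str) m).getD []) [] ∧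
        B z.1.1 z.1.2.2.1 z.2.2 ((decode (α := Str) m).getD []) := by
    have hm : Primrec fun z : ((ℕ × (ℕ × ℕ × ℕ)) × (Str × Str)) × ℕ =>
        (decode (α := Str) z.2).getD [] :=
      Primrec.option_getD.comp (Primrec.decode.comp Primrec.snd) (Primrec.const [])
    have ht : Primrec fun z : ((ℕ × (ℕ × ℕ × ℕ)) × (Str × Str)) × ℕ => z.1.1.1 :=
      Primrec.fst.comp (Primrec.fst.comp Primrec.fst)
    refine primrecPred_exists_lt_fun (Primrec.fst.comp Primrec.fst) (PrimrecPred.and ?_ ?_)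
    · exact hB.comp (Primrec.pair (Primrec.pair ht (Primrec.fst.comp (Primrec.snd.comp
        (Primrec.fst.comp Primrec.fst)))) (Primrec.pair hm (Primrec.const [])))
    · exact hB.comp (Primrec.pair (Primrec.pair ht (Primrec.fst.comp (Primrec.snd.comp
        (Primrec.snd.comp (Primrec.fst.comp Primrec.fst))))) (Primrec.pair (Primrec.snd.comp
          (Primrec.snd.comp Primrec.fst)) hm))
  obtain ⟨d, hd⟩ := exists_KC_le_of_enumerable hU hP
  refine ⟨d, fun r a b h1 h2 => ?_⟩
  refine hd (KC U b [], KC U a b, 0) r _ [] a h1 h2 (by positivity) ?_ ?_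
  · obtain ⟨t1, ht1⟩ := (hBmem (KC U b []) b []).1 le_rfl
    obtain ⟨t2, ht2⟩ := (hBmem (KC U a b) a b).1 le_rfl
    refine ⟨max (max t1 t2) (encode b + 1), encode b, by simp, ?_, ?_⟩
    · simp only [encodek, Option.getD_some]
      exact hBmono _ _ _ _ _ (by simp) ht1
    · simp only [encodek, Option.getD_some]
      exact hBmono _ _ _ _ _ (by simp) ht2
  · intro Z hZ
    classical
    choose! t m _ hy hz using hZ
    simp only at hy hz
    set Y : Finset Str := Z.image fun z => (decode (α := Str) (m z)).getD [] with hY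
    have hYc : Y.card ≤ 2 ^ (KC U b [] + 1) := by
      refine card_le_of_KC_le hU (y := []) Y fun y hyY => ?_
      obtain ⟨z, hz, rfl⟩ := Finset.mem_image.1 hyY
      exact (hBmem _ _ _).2 ⟨_, hy z hz⟩
    have hsub : Z ⊆ Y.biUnion fun y => Z.filter fun z => KC U z y ≤ KC U a b := by
      intro z hzZ
      rw [Finset.mem_biUnion]
      exact ⟨_, Finset.mem_image_of_mem _ hzZ,
        Finset.mem_filter.2 ⟨hzZ, (hBmem _ _ _).2 ⟨_, hz z hzZ⟩⟩⟩
    calc Z.card ≤ Y.card * 2 ^ (KC U a b + 1) :=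
          (Finset.card_le_card hsub).trans (Finset.card_biUnion_le_card_mul _ _ _ fun y _ =>
            card_le_of_KC_le hU _ fun x hx => (Finset.mem_filter.1 hx).2)
      _ ≤ 2 ^ (KC U b [] + 1) * 2 ^ (KC U a b + 1) := Nat.mul_le_mul_right _ hYc
      _ = 2 ^ (KC U b [] + KC U a b + 2) := by ring

/-- Dropping an initial segment of the condition costs at most a logarithmic term. -/
theorem exists_KC_le_of_drop {U : CondMachine} (hU : OptimalMachine U) :
    ∃ d, ∀ (k r i : ℕ) (x v : Str), k < 2 ^ r → v.length < 2 ^ r →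
    KC U x (v.drop i) ≤ k → KC U x v ≤ k + 1 + 9 * r + d := by
  obtain ⟨B, hB, -, hBmem⟩ := exists_stage hU
  have hdrop : Primrec₂ fun (v : Str) (i : ℕ) => v.drop i := by
    refine (Primrec.nat_iterate (f := fun z : Str × ℕ => z.2) (g := fun z : Str × ℕ => z.1)
      (h := fun _ v => v.tail) Primrec.snd Primrec.fst
      (Primrec.list_tail.comp Primrec.snd).to₂).of_eq fun z => ?_
    obtain ⟨v, i⟩ := z
    induction i generalizing v with
    | zero => rfl
    | succ i ih =>
      rw [Function.iterate_succ_apply, ih]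
      exact List.drop_tail
  have hP : PrimrecPred fun z : (ℕ × (ℕ × ℕ × ℕ)) × (Str × Str) =>
      ∃ i < z.2.1.length + 1, B z.1.1 z.1.2.1 z.2.2 (z.2.1.drop i) := by
    refine primrecPred_exists_lt_fun (Primrec.succ.comp (Primrec.list_length.comp
      (Primrec.fst.comp Primrec.snd))) ?_
    refine hB.comp (Primrec.pair (Primrec.pair ?_ ?_) (Primrec.pair ?_
      (hdrop.comp (Primrec.fst.comp (Primrec.snd.comp Primrec.fst)) Primrec.snd)))
    · exact Primrec.fst.comp (Primrec.fst.comp Primrec.fst)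
    · exact Primrec.fst.comp (Primrec.snd.comp (Primrec.fst.comp Primrec.fst))
    · exact Primrec.snd.comp (Primrec.snd.comp Primrec.fst)
  obtain ⟨d, hd⟩ := exists_KC_le_of_enumerable hU hP
  refine ⟨d, fun k r i x v hk hv hx => ?_⟩
  have := hd (k, 0, 0) r (k + 1 + r) v x hk (by positivity) (by positivity) ?_ ?_
  · omega
  · rcases le_total i v.length with hi | hi
    · obtain ⟨t, ht⟩ := (hBmem _ _ _).1 hx
      exact ⟨t, i, Nat.lt_succ_of_le hi, ht⟩
    · rw [List.drop_of_length_le hi, ← List.drop_length (l := v)] at hx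
      obtain ⟨t, ht⟩ := (hBmem _ _ _).1 hx
      exact ⟨t, v.length, Nat.lt_succ_self _, ht⟩
  · intro Z hZ
    classical
    have hsub : Z ⊆ (Finset.range (v.length + 1)).biUnion fun i =>
        Z.filter fun z => KC U z (v.drop i) ≤ k := by
      intro z hz
      obtain ⟨t, i, hi, ht⟩ := hZ z hz
      rw [Finset.mem_biUnion]
      exact ⟨i, Finset.mem_range.2 hi, Finset.mem_filter.2 ⟨hz, (hBmem _ _ _).2 ⟨t, ht⟩⟩⟩
    calc Z.card ≤ (Finset.range (v.length + 1)).card * 2 ^ (k + 1) :=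
          (Finset.card_le_card hsub).trans (Finset.card_biUnion_le_card_mul _ _ _ fun y _ =>
            card_le_of_KC_le hU _ fun x hx => (Finset.mem_filter.1 hx).2)
      _ ≤ 2 ^ r * 2 ^ (k + 1) := by
          rw [Finset.card_range]
          exact Nat.mul_le_mul_right _ hv
      _ = 2 ^ (k + 1 + r) := by ring

theorem one_le_log2 (n : ℕ) : 1 ≤ log2 n :=
  Nat.log_pos one_lt_two (by omega)

theorem two_mul_add_four_lt_two_pow (n : ℕ) : 2 * n + 4 < 2 ^ (3 * log2 n) := by
  have h1 : n + 2 < 2 ^ (log2 n + 1) := Nat.lt_pow_succ_log_self one_lt_two _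
  have h2 : 2 ^ (log2 n + 2) ≤ 2 ^ (3 * log2 n) :=
    Nat.pow_le_pow_right two_pos (by have := one_le_log2 n; omega)
  rw [pow_succ] at h1 h2
  rw [pow_succ] at h2
  omega

/-- Some oracle makes `a` much simpler than its half while `b` remains above its half. -/
theorem exists_separating_oracle {U : CondMachine} (hU : OptimalMachine U) (κ : ℕ) :
    ∃ c : ℕ, ∀ a b : Str,
      c * log2 (KC U a [] + KC U b []) ≤ KC U a [] →
      c * log2 (KC U a [] + KC U b []) ≤ KC U b [] →
      c * log2 (KC U a [] + KC U b []) ≤ KC U a b →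
      ∃ u : Str, u.length = 2 * KC U a [] + 2 ∧
        KC U a u + κ * log2 (KC U a [] + KC U b []) ≤ KC U a [] / 2 ∧
        KC U b [] / 2 + κ * log2 (KC U a [] + KC U b []) ≤ KC U b u := by
  obtain ⟨d₁, hline⟩ := exists_KC_lineStr_le hU
  obtain ⟨d₂, hhits⟩ := exists_KC_le_of_forall_hits hU
  obtain ⟨d₃, hcard⟩ := exists_KC_le_of_card_lines hU
  obtain ⟨d₄, hchain⟩ := exists_KC_le_KC_add_KC hU
  obtain ⟨d₅, hcond⟩ := exists_KC_le_KC_comp hU (φ := fun _ => []) (Computable.const [])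
  refine ⟨10 * κ + 10 * d₁ + 10 * d₂ + 10 * d₃ + 10 * d₄ + d₅ + 1000, fun a b ha hb hab => ?_⟩
  set L := log2 (KC U a [] + KC U b []) with hL
  have hL1 : 1 ≤ L := one_le_log2 _
  have hr := two_mul_add_four_lt_two_pow (KC U a [] + KC U b [])
  rw [← hL] at hr
  rw [show (10 * κ + 10 * d₁ + 10 * d₂ + 10 * d₃ + 10 * d₄ + d₅ + 1000) * L = 10 * (κ * L) +
    10 * (d₁ * L) + 10 * (d₂ * L) + 10 * (d₃ * L) + 10 * (d₄ * L) + d₅ * L + 1000 * L by ring]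
    at ha hb hab
  have hd₁ := Nat.le_mul_of_pos_right d₁ hL1
  have hd₂ := Nat.le_mul_of_pos_right d₂ hL1
  have hd₃ := Nat.le_mul_of_pos_right d₃ hL1
  have hd₄ := Nat.le_mul_of_pos_right d₄ hL1
  have hd₅ := Nat.le_mul_of_pos_right d₅ hL1
  have hba := hcond a b
  obtain ⟨p, hp, hlen⟩ := exists_program hU a []
  set N := KC U a [] with hN
  obtain ⟨l, hl⟩ : ∃ l, l + κ * L + 24 * L + d₁ * L = N / 2 :=
    ⟨N / 2 - κ * L - 24 * L - d₁ * L, by omega⟩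
  set k := KC U b [] / 2 + κ * L with hk
  by_contra! hno
  have hbad : ∀ X < primeAbove N * primeAbove N, Hits (primeAbove N) (2 ^ l) X (strVal p) →
      KC U b (lineStr N X) ≤ k := by
    intro X hX hXp
    have h1 := hline N l (3 * L) X a p (by omega) (by omega) hlen hp hX hXp
    exact (hno (lineStr N X) (length_strOfNat _ _) (by omega)).le
  obtain ⟨e, he⟩ : ∃ e, e + 24 * L + d₂ * L + 1 = KC U a b :=
    ⟨KC U a b - 24 * L - d₂ * L - 1, by omega⟩
  obtain ⟨S, hS, hSe⟩ : ∃ S : Finset ℕ, (∀ P ∈ S, P < 2 ^ N ∧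
      ∀ X < primeAbove N * primeAbove N, Hits (primeAbove N) (2 ^ l) X P →
        KC U b (lineStr N X) ≤ k) ∧ 2 ^ e < S.card := by
    by_contra! hS
    have := hhits N l k (3 * L) e a b p (by omega) (by omega) (by omega) hlen hp hbad hS
    omega
  obtain ⟨e', he'⟩ : ∃ e', e' = min e (N - 1 - l) := ⟨_, rfl⟩
  obtain ⟨T, hTS, hT⟩ := Finset.exists_subset_card_eq
    ((Nat.pow_le_pow_right two_pos (he' ▸ min_le_left e _)).trans hSe.le : 2 ^ e' ≤ S.card)
  have hq := two_pow_lt_primeAbove N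
  have hg : 2 ^ (e' + l) * 2 < primeAbove N := by
    rw [← pow_succ]
    exact (Nat.pow_le_pow_right two_pos (by omega)).trans_lt hq
  have hlines := card_mul_le_card_hits (prime_primeAbove N)
    ((Nat.pow_le_pow_right two_pos (by omega : l ≤ N)).trans hq.le) T
    fun P hP => (hS P (hTS hP)).1.trans hq
  rw [hT, ← pow_add, add_comm l e'] at hlines
  classical
  have hb' := hcard N k (e' + l) (3 * L) b (by omega) (by omega) (by omega) (by omega) ?_
  · have := hchain (3 * L) a b (by omega) (by omega)
    rcases min_choice e (N - 1 - l) with h | h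
    · rw [h] at he'
      omega
    · rw [h] at he'
      omega
  · have hsq : 2 * (2 ^ (e' + l) * 2 ^ (e' + l)) ≤ 2 ^ (e' + l) * primeAbove N := by
      rw [mul_left_comm, mul_comm 2]
      exact Nat.mul_le_mul_left _ hg.le
    refine le_trans ?_ (Nat.mul_le_mul_left 2 (Finset.card_le_card
      (s := (Finset.range (primeAbove N * primeAbove N)).filter
        fun X => ∃ P ∈ T, Hits (primeAbove N) (2 ^ l) X P) fun X hX => ?_))
    · omega
    · rw [Finset.mem_filter, Finset.mem_range] at hX ⊢
      obtain ⟨hX, P, hP, hXP⟩ := hX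
      exact ⟨hX, (hS P (hTS hP)).2 X hX hXP⟩

/-- A code of the pair `(u, v)` by a string. -/
def pairStr (u v : Str) : Str := List.replicate (encode (u, v)) true

/-- The pair coded by a string. -/
def unpairStr (y : Str) : Str × Str := (decode (α := Str × Str) y.length).getD ([], [])

theorem unpairStr_pairStr (u v : Str) : unpairStr (pairStr u v) = (u, v) := by
  simp [unpairStr, pairStr]

theorem computable_unpairStr : Computable unpairStr :=
  (Primrec.option_getD.comp (Primrec.decode.comp Primrec.list_length)
    (Primrec.const ([], []))).to_comp

theorem computable_pairStr : Computable₂ pairStr := by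
  have h : Primrec fun n : ℕ => (List.range n).map fun _ => true :=
    Primrec.list_map Primrec.list_range (Primrec.const true).to₂
  refine (h.comp (Primrec.encode (α := Str × Str))).to_comp.of_eq fun z => ?_
  simp [pairStr]

theorem exists_KC_pairStr_le {U : CondMachine} (hU : OptimalMachine U) {ψ : Str × Str → Str}
    (hψ : Computable ψ) : ∃ d, ∀ x u v, KC U x (pairStr u v) ≤ KC U x (ψ (u, v)) + d := by
  obtain ⟨d, hd⟩ := exists_KC_le_KC_comp hU (hψ.comp computable_unpairStr)
  refine ⟨d, fun x u v => ?_⟩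
  simpa only [unpairStr_pairStr] using hd x (pairStr u v)

theorem exists_abs_KC_pairStr_cons_le {U : CondMachine} (hU : OptimalMachine U) :
    ∃ d : ℕ, ∀ (x u v : Str) (β : Bool),
      |(KC U x (pairStr u v) : ℤ) - KC U x (pairStr (β :: u) v)| ≤ d ∧
      |(KC U x (pairStr u v) : ℤ) - KC U x (pairStr u (β :: v))| ≤ d := by
  have htail : Computable (List.tail : Str → Str) := Primrec.list_tail.to_comp
  have hcons : ∀ β : Bool, Computable fun u : Str => β :: u := fun β =>
    Computable.list_cons.comp (Computable.const β) Computable.id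
  have hfst : Computable fun z : Str × Str => z.1 := Computable.fst
  have hsnd : Computable fun z : Str × Str => z.2 := Computable.snd
  obtain ⟨d₁, h₁⟩ := exists_KC_pairStr_le hU (computable_pairStr.comp (htail.comp hfst) hsnd)
  obtain ⟨d₂, h₂⟩ := exists_KC_pairStr_le hU (computable_pairStr.comp hfst (htail.comp hsnd))
  choose d₃ h₃ using fun β =>
    exists_KC_pairStr_le hU (computable_pairStr.comp ((hcons β).comp hfst) hsnd)
  choose d₄ h₄ using fun β =>
    exists_KC_pairStr_le hU (computable_pairStr.comp hfst ((hcons β).comp hsnd))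
  refine ⟨d₁ + d₂ + (d₃ true + d₃ false) + (d₄ true + d₄ false), fun x u v β => ?_⟩
  have h1 := h₁ x (β :: u) v
  have h2 := h₂ x u (β :: v)
  have h3 := h₃ β x u v
  have h4 := h₄ β x u v
  simp only [List.tail_cons] at h1 h2 h3 h4
  have h5 : d₃ β ≤ d₃ true + d₃ false := by cases β <;> omega
  have h6 : d₄ β ≤ d₄ true + d₄ false := by cases β <;> omega
  simp only [abs_le]
  push_cast
  omega

/-- If `x` is simple relative to a suffix of `v`, coded with an empty string on either side,
then it is simple relative to `v`. -/
theorem exists_KC_le_of_pairStr_drop {U : CondMachine} (hU : OptimalMachine U) :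
    ∃ d, ∀ (k r i : ℕ) (x v : Str), k + d < 2 ^ r → v.length < 2 ^ r →
      (KC U x (pairStr [] (v.drop i)) ≤ k ∨ KC U x (pairStr (v.drop i) []) ≤ k) →
      KC U x v ≤ k + 9 * r + d := by
  obtain ⟨d₁, h₁⟩ := exists_KC_le_KC_comp hU
    (computable_pairStr.comp (Computable.const []) Computable.id)
  obtain ⟨d₂, h₂⟩ := exists_KC_le_KC_comp hU
    (computable_pairStr.comp Computable.id (Computable.const []))
  obtain ⟨d₃, h₃⟩ := exists_KC_le_of_drop hU
  refine ⟨d₁ + d₂ + d₃ + 1, fun k r i x v hk hv h => ?_⟩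
  have h1 : KC U x (v.drop i) ≤ KC U x (pairStr [] (v.drop i)) + d₁ := h₁ x (v.drop i)
  have h2 : KC U x (v.drop i) ≤ KC U x (pairStr (v.drop i) []) + d₂ := h₂ x (v.drop i)
  have := h₃ (k + d₁ + d₂) r i x v (by omega) hv (by omega)
  omega

/-- Halving corollary of Theorem 3: if `C(a)`, `C(b)`, `C(a|b)`, `C(b|a)` are
all at least `c·log n` (where `n = C(a) + C(b)`), then one can cut both
complexities in half by adding an oracle. -/
theorem halving_by_oracle (U : CondMachine) (hU : OptimalMachine U) :
    ∃ c : ℕ, ∀ a b : Str,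
      c * log2 (KC U a [] + KC U b []) ≤ KC U a [] →
      c * log2 (KC U a [] + KC U b []) ≤ KC U b [] →
      c * log2 (KC U a [] + KC U b []) ≤ KC U a b →
      c * log2 (KC U a [] + KC U b []) ≤ KC U b a →
      ∃ y : Str, |(KC U a y : ℤ) - ((KC U a [] / 2 : ℕ) : ℤ)| ≤ (c : ℤ) ∧
        |(KC U b y : ℤ) - ((KC U b [] / 2 : ℕ) : ℤ)| ≤ (c : ℤ) := by
  obtain ⟨d₁, hfst⟩ := exists_KC_pairStr_le hU (ψ := Prod.fst) Computable.fst
  obtain ⟨d₂, hsnd⟩ := exists_KC_pairStr_le hU (ψ := Prod.snd) Computable.snd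
  obtain ⟨d₃, hdrop⟩ := exists_KC_le_of_pairStr_drop hU
  obtain ⟨d₄, hstep⟩ := exists_abs_KC_pairStr_cons_le hU
  set κ := d₁ + d₂ + d₃ + 28 with hκ
  obtain ⟨c, hsep⟩ := exists_separating_oracle hU κ
  refine ⟨c + 2 * d₃ + 2 * d₄, fun a b ha hb hab hba => ?_⟩
  set L := log2 (KC U a [] + KC U b []) with hL
  have hL1 : 1 ≤ L := one_le_log2 _
  have hr := two_mul_add_four_lt_two_pow (KC U a [] + KC U b [])
  rw [← hL] at hr
  have hc : c * L ≤ (c + 2 * d₃ + 2 * d₄) * L := Nat.mul_le_mul_right _ (by omega)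
  have hd₃ : 2 * d₃ ≤ (c + 2 * d₃ + 2 * d₄) * L :=
    (by omega : 2 * d₃ ≤ c + 2 * d₃ + 2 * d₄).trans (Nat.le_mul_of_pos_right _ hL1)
  have hκL : d₁ + d₂ + d₃ + 28 * L ≤ κ * L := by
    have := Nat.le_mul_of_pos_right (d₁ + d₂ + d₃) hL1
    rw [hκ, add_mul]
    omega
  obtain ⟨u, hu, hau, hbu⟩ := hsep a b (hc.trans ha) (hc.trans hb) (hc.trans hab)
  obtain ⟨v, hv, hbv, hav⟩ := hsep b a (by rw [add_comm (KC U b [])]; exact hc.trans hb)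
    (by rw [add_comm (KC U b [])]; exact hc.trans ha)
    (by rw [add_comm (KC U b [])]; exact hc.trans hba)
  rw [add_comm (KC U b []), ← hL] at hbv hav
  rw [← hL] at hau hbu
  have hstepi : ∀ (x : Str) (i j : ℕ), i < u.length →
      |(KC U x (pairStr (u.drop (i + 1)) (v.drop j)) : ℤ) -
        KC U x (pairStr (u.drop i) (v.drop j))| ≤ (d₄ : ℤ) := by
    intro x i j hi
    rw [List.drop_eq_getElem_cons hi]
    exact (hstep x _ _ _).1
  have hstepj : ∀ (x : Str) (i j : ℕ), j < v.length →
      |(KC U x (pairStr (u.drop i) (v.drop (j + 1))) : ℤ) -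
        KC U x (pairStr (u.drop i) (v.drop j))| ≤ (d₄ : ℤ) := by
    intro x i j hj
    rw [List.drop_eq_getElem_cons hj]
    exact (hstep x _ _ _).2
  obtain ⟨i, -, j, -, hi, hj⟩ := exists_close_of_boundary
    (f := fun i j => (KC U a (pairStr (u.drop i) (v.drop j)) : ℤ))
    (g := fun i j => (KC U b (pairStr (u.drop i) (v.drop j)) : ℤ))
    (s := ((KC U a [] / 2 : ℕ) : ℤ)) (t := ((KC U b [] / 2 : ℕ) : ℤ))
    (hstepi a) (hstepj a) (hstepi b) (hstepj b)
    (fun j _ => by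
      have h : KC U a (pairStr u (v.drop j)) ≤ KC U a u + d₁ := hfst a u (v.drop j)
      simp only [List.drop_zero]
      omega)
    (fun j _ => by
      by_contra h
      simp only [List.drop_length] at h
      have := hdrop (KC U a [] / 2) (3 * L) j a v (by omega) (by omega) (Or.inl (by omega))
      omega)
    (fun i _ => by
      have h : KC U b (pairStr (u.drop i) v) ≤ KC U b v + d₂ := hsnd b (u.drop i) v
      simp only [List.drop_zero]
      omega)
    (fun i _ => by
      by_contra h
      simp only [List.drop_length] at h
      have := hdrop (KC U b [] / 2) (3 * L) i b u (by omega) (by omega) (Or.inr (by omega))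
      omega)
  refine ⟨pairStr (u.drop i) (v.drop j), hi.trans ?_, hj.trans ?_⟩ <;>
  · push_cast
    omega
end

section
/- (Three-dimensional discrete covering lemma) Let c, D, M₁, M₂, M₃ ∈ ℕ with M₁, M₂, M₃ ≥ 1, and let f : R → ℤ³ satisfy: (i) ‖f(p) − f(p')‖∞ ≤ c for all adjacent p, p' ∈ R; and (ii) ‖f(p) − p‖∞ ≤ D for all p ∈ ∂R. Then for every q ∈ R whose ℓ∞-distance to every point of ∂R is at least D + 1, there exists p ∈ R with ‖f(p) − q‖∞ ≤ 3c. -/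
/-- The ℓ∞ (Chebyshev) distance on `ℤ³`. -/
def chebDist3 (p q : ℤ × ℤ × ℤ) : ℤ :=
  max |p.1 - q.1| (max |p.2.1 - q.2.1| |p.2.2 - q.2.2|)

/-- Two points of `ℤ³` are adjacent if they differ by exactly 1 in exactly one
coordinate. -/
def Adj3 (p q : ℤ × ℤ × ℤ) : Prop :=
  (|p.1 - q.1| = 1 ∧ p.2.1 = q.2.1 ∧ p.2.2 = q.2.2) ∨
  (p.1 = q.1 ∧ |p.2.1 - q.2.1| = 1 ∧ p.2.2 = q.2.2) ∨
  (p.1 = q.1 ∧ p.2.1 = q.2.1 ∧ |p.2.2 - q.2.2| = 1)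

/-- The discrete box `R = {0,…,M₁} × {0,…,M₂} × {0,…,M₃} ⊆ ℤ³`. -/
def Box3 (M₁ M₂ M₃ : ℕ) : Set (ℤ × ℤ × ℤ) :=
  {p | 0 ≤ p.1 ∧ p.1 ≤ (M₁ : ℤ) ∧ 0 ≤ p.2.1 ∧ p.2.1 ≤ (M₂ : ℤ) ∧
       0 ≤ p.2.2 ∧ p.2.2 ≤ (M₃ : ℤ)}

/-- The boundary of the discrete box. -/
def Bdry3 (M₁ M₂ M₃ : ℕ) : Set (ℤ × ℤ × ℤ) :=
  {p ∈ Box3 M₁ M₂ M₃ | p.1 = 0 ∨ p.1 = (M₁ : ℤ) ∨ p.2.1 = 0 ∨ p.2.1 = (M₂ : ℤ) ∨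
    p.2.2 = 0 ∨ p.2.2 = (M₃ : ℤ)}

/-- The mod 2 indicator that a simplex has vertex labels exactly `0, 1, 2, 3`. -/
def tetraCochain (a b c d : Fin 4) : ZMod 2 :=
  if ∀ i : Fin 4, a = i ∨ b = i ∨ c = i ∨ d = i then 1 else 0

/-- The mod 2 indicator that a triangle has vertex labels exactly `0, 1, 2`. -/
def triCochain (a b c : Fin 4) : ZMod 2 :=
  if ∀ i : Fin 4, i ≠ 3 ↔ (a = i ∨ b = i ∨ c = i) then 1 else 0

/-- The mod 2 indicator that an edge has vertex labels exactly `0, 1`. -/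
def edgeCochain (a b : Fin 4) : ZMod 2 :=
  if (a = 0 ∧ b = 1) ∨ (a = 1 ∧ b = 0) then 1 else 0

/-- The mod 2 indicator of the label `0`. -/
def vertexCochain (a : Fin 4) : ZMod 2 := if a = 0 then 1 else 0

set_option maxRecDepth 100000 in
theorem tetraCochain_eq_coboundary : ∀ a b c d : Fin 4, tetraCochain a b c d =
    triCochain b c d + triCochain a c d + triCochain a b d + triCochain a b c := by
  decide

theorem triCochain_eq_coboundary : ∀ a b c : Fin 4, a ≤ 2 → b ≤ 2 → c ≤ 2 →
    triCochain a b c = edgeCochain b c + edgeCochain a c + edgeCochain a b := by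
  decide

theorem edgeCochain_eq_coboundary : ∀ a b : Fin 4, a ≤ 1 → b ≤ 1 →
    edgeCochain a b = vertexCochain b + vertexCochain a := by
  decide

theorem triCochain_eq_zero_of_missing : ∀ i a b c : Fin 4, i ≠ 3 → a ≠ i → b ≠ i → c ≠ i →
    triCochain a b c = 0 := by
  decide

theorem edgeCochain_eq_zero_of_missing : ∀ i a b : Fin 4, i ≤ 1 → a ≠ i → b ≠ i →
    edgeCochain a b = 0 := by
  decide

theorem sum_range_coboundary (g : ℕ → ZMod 2) (n : ℕ) :
    ∑ i ∈ Finset.range n, (g (i + 1) + g i) = g n + g 0 := by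
  simpa only [CharTwo.sub_eq_add] using Finset.sum_range_sub g n

/-- Mod 2 divergence theorem on a rectangle, for a flux `A` vanishing on two opposite sides. -/
theorem sum_range_divergence (M N : ℕ) (A B C : ℕ → ℕ → ZMod 2)
    (h : ∀ x < M, ∀ y < N, C x y = (A (x + 1) y + A x y) + (B x (y + 1) + B x y))
    (hA₀ : ∀ y < N, A 0 y = 0) (hA : ∀ y < N, A M y = 0) :
    ∑ x ∈ Finset.range M, ∑ y ∈ Finset.range N, C x y =
      ∑ x ∈ Finset.range M, (B x N + B x 0) := by
  have hC : ∑ x ∈ Finset.range M, ∑ y ∈ Finset.range N, C x y =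
      ∑ x ∈ Finset.range M, ∑ y ∈ Finset.range N,
        ((A (x + 1) y + A x y) + (B x (y + 1) + B x y)) :=
    Finset.sum_congr rfl fun x hx => Finset.sum_congr rfl fun y hy =>
      h x (Finset.mem_range.1 hx) y (Finset.mem_range.1 hy)
  have hAsum : ∑ x ∈ Finset.range M, ∑ y ∈ Finset.range N, (A (x + 1) y + A x y) = 0 := by
    rw [Finset.sum_comm]
    refine Finset.sum_eq_zero fun y hy => ?_
    rw [sum_range_coboundary (fun x => A x y), hA y (Finset.mem_range.1 hy),
      hA₀ y (Finset.mem_range.1 hy), add_zero]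
  have hBsum : ∀ x, ∑ y ∈ Finset.range N, (B x (y + 1) + B x y) = B x N + B x 0 :=
    fun x => sum_range_coboundary (B x) N
  rw [hC, Finset.sum_congr rfl fun x _ => Finset.sum_add_distrib, Finset.sum_add_distrib, hAsum,
    zero_add]
  exact Finset.sum_congr rfl fun x _ => hBsum x

/-- Sum of `triCochain` over the two triangles of the unit square with corners labelled
`a` (lowest), `b`, `c` and `d` (highest). -/
def squareCochain (a b c d : Fin 4) : ZMod 2 := triCochain a b d + triCochain a c d

theorem squareCochain_eq_zero_of_missing {i a b c d : Fin 4} (hi : i ≠ 3) (ha : a ≠ i)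
    (hb : b ≠ i) (hc : c ≠ i) (hd : d ≠ i) : squareCochain a b c d = 0 := by
  rw [squareCochain, triCochain_eq_zero_of_missing i a b d hi ha hb hd,
    triCochain_eq_zero_of_missing i a c d hi ha hc hd, add_zero]

/-- Two-dimensional Sperner lemma on a triangulated rectangle, in parity form. -/
theorem sum_squareCochain_eq_one (M N : ℕ) (l : ℕ → ℕ → Fin 4)
    (h₂ : ∀ x ≤ M, ∀ y ≤ N, l x y ≤ 2)
    (hx₀ : ∀ y ≤ N, l 0 y = 0) (hx : ∀ y ≤ N, l M y ≠ 0)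
    (hy₀ : ∀ x ≤ M, l x 0 ≤ 1) (hy : ∀ x ≤ M, l x N ≠ 1) :
    ∑ x ∈ Finset.range M, ∑ y ∈ Finset.range N,
      squareCochain (l x y) (l (x + 1) y) (l x (y + 1)) (l (x + 1) (y + 1)) = 1 := by
  rw [sum_range_divergence M N (fun x y => edgeCochain (l x y) (l x (y + 1)))
    (fun x y => edgeCochain (l x y) (l (x + 1) y))]
  · have hbottom : ∀ x ∈ Finset.range M,
        edgeCochain (l x N) (l (x + 1) N) + edgeCochain (l x 0) (l (x + 1) 0) =
          vertexCochain (l (x + 1) 0) + vertexCochain (l x 0) := fun x hxM => by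
      have hxM := Finset.mem_range.1 hxM
      rw [edgeCochain_eq_zero_of_missing 1 _ _ le_rfl (hy x hxM.le) (hy (x + 1) hxM), zero_add,
        edgeCochain_eq_coboundary _ _ (hy₀ x hxM.le) (hy₀ (x + 1) hxM)]
    rw [Finset.sum_congr rfl hbottom, sum_range_coboundary (fun x => vertexCochain (l x 0))]
    simp [vertexCochain, hx₀ 0 (Nat.zero_le _), hx 0 (Nat.zero_le _)]
  · intro x hxM y hyN
    rw [squareCochain,
      triCochain_eq_coboundary _ _ _ (h₂ x hxM.le y hyN.le) (h₂ (x + 1) hxM y hyN.le)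
        (h₂ (x + 1) hxM (y + 1) hyN),
      triCochain_eq_coboundary _ _ _ (h₂ x hxM.le y hyN.le) (h₂ x hxM.le (y + 1) hyN)
        (h₂ (x + 1) hxM (y + 1) hyN)]
    linear_combination CharTwo.add_self_eq_zero (edgeCochain (l x y) (l (x + 1) (y + 1)))
  · intro y hyN
    exact edgeCochain_eq_zero_of_missing 1 _ _ le_rfl (by simp [hx₀ y hyN.le])
      (by simp [hx₀ (y + 1) hyN])
  · intro y hyN
    exact edgeCochain_eq_zero_of_missing 0 _ _ (by decide) (hx y hyN.le) (hx (y + 1) hyN)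

/-- Three-dimensional Sperner lemma on a box: a labelling with labels `0, 1, 2, 3`, which
avoids `i` on the `i`-th upper face and is at most `i` on the `i`-th lower face, takes all
four values on some path of four points with consecutive points adjacent. -/
theorem exists_fully_labelled_path (M₁ M₂ M₃ : ℕ) (l : ℤ × ℤ × ℤ → Fin 4)
    (hx₀ : ∀ p ∈ Box3 M₁ M₂ M₃, p.1 = 0 → l p = 0)
    (hx : ∀ p ∈ Box3 M₁ M₂ M₃, p.1 = M₁ → l p ≠ 0)
    (hy₀ : ∀ p ∈ Box3 M₁ M₂ M₃, p.2.1 = 0 → l p ≤ 1)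
    (hy : ∀ p ∈ Box3 M₁ M₂ M₃, p.2.1 = M₂ → l p ≠ 1)
    (hz₀ : ∀ p ∈ Box3 M₁ M₂ M₃, p.2.2 = 0 → l p ≤ 2)
    (hz : ∀ p ∈ Box3 M₁ M₂ M₃, p.2.2 = M₃ → l p ≠ 2) :
    ∃ a ∈ Box3 M₁ M₂ M₃, ∃ b ∈ Box3 M₁ M₂ M₃, ∃ c ∈ Box3 M₁ M₂ M₃, ∃ d ∈ Box3 M₁ M₂ M₃,
      Adj3 a b ∧ Adj3 b c ∧ Adj3 c d ∧
        ∀ i : Fin 4, l a = i ∨ l b = i ∨ l c = i ∨ l d = i := by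
  by_contra hcon
  have hzero : ∀ a ∈ Box3 M₁ M₂ M₃, ∀ b ∈ Box3 M₁ M₂ M₃, ∀ c ∈ Box3 M₁ M₂ M₃,
      ∀ d ∈ Box3 M₁ M₂ M₃, Adj3 a b → Adj3 b c → Adj3 c d →
        triCochain (l b) (l c) (l d) + triCochain (l a) (l c) (l d) +
          triCochain (l a) (l b) (l d) + triCochain (l a) (l b) (l c) = 0 := by
    intro a ha b hb c hc d hd hab hbc hcd
    rw [← tetraCochain_eq_coboundary, tetraCochain, if_neg]
    exact fun h => hcon ⟨a, ha, b, hb, c, hc, d, hd, hab, hbc, hcd, h⟩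
  let g : ℕ → ℕ → ℕ → Fin 4 := fun x y z => l (x, y, z)
  have hbox : ∀ x y z : ℕ, x ≤ M₁ → y ≤ M₂ → z ≤ M₃ →
      ((x : ℤ), (y : ℤ), (z : ℤ)) ∈ Box3 M₁ M₂ M₃ := by
    intro x y z h₁ h₂ h₃
    simp only [Box3, Set.mem_ofPred_eq]
    omega
  have hadj₁ : ∀ x y z : ℕ, Adj3 (x, y, z) ((x + 1 : ℕ), y, z) := by simp [Adj3]
  have hadj₂ : ∀ x y z : ℕ, Adj3 (x, y, z) (x, (y + 1 : ℕ), z) := by simp [Adj3]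
  have hadj₃ : ∀ x y z : ℕ, Adj3 (x, y, z) (x, y, (z + 1 : ℕ)) := by simp [Adj3]
  let S : ℕ → ℕ → ℕ → ZMod 2 := fun z x y =>
    squareCochain (g x y z) (g (x + 1) y z) (g x (y + 1) z) (g (x + 1) (y + 1) z)
  let A : ℕ → ℕ → ℕ → ZMod 2 := fun z x y =>
    squareCochain (g x y z) (g x (y + 1) z) (g x y (z + 1)) (g x (y + 1) (z + 1))
  let B : ℕ → ℕ → ℕ → ZMod 2 := fun z x y =>
    squareCochain (g x y z) (g (x + 1) y z) (g x y (z + 1)) (g (x + 1) y (z + 1))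
  have hcube : ∀ z < M₃, ∀ x < M₁, ∀ y < M₂,
      S z x y + S (z + 1) x y = (A z (x + 1) y + A z x y) + (B z x (y + 1) + B z x y) := by
    intro z hz' x hx' y hy'
    have b000 := hbox x y z hx'.le hy'.le hz'.le
    have b100 := hbox (x + 1) y z hx' hy'.le hz'.le
    have b010 := hbox x (y + 1) z hx'.le hy' hz'.le
    have b001 := hbox x y (z + 1) hx'.le hy'.le hz'
    have b110 := hbox (x + 1) (y + 1) z hx' hy' hz'.le
    have b101 := hbox (x + 1) y (z + 1) hx' hy'.le hz'
    have b011 := hbox x (y + 1) (z + 1) hx'.le hy' hz'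
    have b111 := hbox (x + 1) (y + 1) (z + 1) hx' hy' hz'
    have e₁ := hzero _ b000 _ b100 _ b110 _ b111 (hadj₁ ..) (hadj₂ ..) (hadj₃ ..)
    have e₂ := hzero _ b000 _ b100 _ b101 _ b111 (hadj₁ ..) (hadj₃ ..) (hadj₂ ..)
    have e₃ := hzero _ b000 _ b010 _ b110 _ b111 (hadj₂ ..) (hadj₁ ..) (hadj₃ ..)
    have e₄ := hzero _ b000 _ b010 _ b011 _ b111 (hadj₂ ..) (hadj₃ ..) (hadj₁ ..)
    have e₅ := hzero _ b000 _ b001 _ b101 _ b111 (hadj₃ ..) (hadj₁ ..) (hadj₂ ..)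
    have e₆ := hzero _ b000 _ b001 _ b011 _ b111 (hadj₃ ..) (hadj₂ ..) (hadj₁ ..)
    have two : (2 : ZMod 2) = 0 := rfl
    let inner : ℕ → ℕ → ℕ → ZMod 2 := fun x' y' z' =>
      triCochain (g x y z) (g x' y' z') (g (x + 1) (y + 1) (z + 1))
    linear_combination (norm := (simp only [S, A, B, g, inner, squareCochain]; ring))
      e₁ + e₂ + e₃ + e₄ + e₅ + e₆ -
      (A z (x + 1) y + A z x y + B z x (y + 1) + B z x y +
        inner (x + 1) y z + inner x (y + 1) z + inner x y (z + 1) +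
        inner (x + 1) (y + 1) z + inner (x + 1) y (z + 1) + inner x (y + 1) (z + 1)) * two
  have hslice : ∀ z < M₃, ∑ x ∈ Finset.range M₁, ∑ y ∈ Finset.range M₂, S z x y =
      ∑ x ∈ Finset.range M₁, ∑ y ∈ Finset.range M₂, S (z + 1) x y := by
    intro z hz'
    have h := sum_range_divergence M₁ M₂ (A z) (B z) (fun x y => S z x y + S (z + 1) x y)
      (hcube z hz')
      (fun y hy' => squareCochain_eq_zero_of_missing (i := 1) (by decide)
        (by simp [g, hx₀ _ (hbox 0 y z (by omega) (by omega) (by omega)) rfl])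
        (by simp [g, hx₀ _ (hbox 0 (y + 1) z (by omega) (by omega) (by omega)) rfl])
        (by simp [g, hx₀ _ (hbox 0 y (z + 1) (by omega) (by omega) (by omega)) rfl])
        (by simp [g, hx₀ _ (hbox 0 (y + 1) (z + 1) (by omega) (by omega) (by omega)) rfl]))
      (fun y hy' => squareCochain_eq_zero_of_missing (i := 0) (by decide)
        (hx _ (hbox M₁ y z (by omega) (by omega) (by omega)) rfl)
        (hx _ (hbox M₁ (y + 1) z (by omega) (by omega) (by omega)) rfl)
        (hx _ (hbox M₁ y (z + 1) (by omega) (by omega) (by omega)) rfl)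
        (hx _ (hbox M₁ (y + 1) (z + 1) (by omega) (by omega) (by omega)) rfl))
    have hne : ∀ a : Fin 4, a ≤ 1 → a ≠ 2 := by decide
    rw [Finset.sum_eq_zero (f := fun x => B z x M₂ + B z x 0)] at h
    · simp only [Finset.sum_add_distrib] at h
      exact CharTwo.add_eq_zero.1 h
    · intro x hx'
      have hx' := Finset.mem_range.1 hx'
      rw [CharTwo.add_eq_zero]
      exact (squareCochain_eq_zero_of_missing (i := 1) (by decide)
        (hy _ (hbox x M₂ z (by omega) (by omega) (by omega)) rfl)
        (hy _ (hbox (x + 1) M₂ z (by omega) (by omega) (by omega)) rfl)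
        (hy _ (hbox x M₂ (z + 1) (by omega) (by omega) (by omega)) rfl)
        (hy _ (hbox (x + 1) M₂ (z + 1) (by omega) (by omega) (by omega)) rfl)).trans
        (squareCochain_eq_zero_of_missing (i := 2) (by decide)
        (hne _ (hy₀ _ (hbox x 0 z (by omega) (by omega) (by omega)) rfl))
        (hne _ (hy₀ _ (hbox (x + 1) 0 z (by omega) (by omega) (by omega)) rfl))
        (hne _ (hy₀ _ (hbox x 0 (z + 1) (by omega) (by omega) (by omega)) rfl))
        (hne _ (hy₀ _ (hbox (x + 1) 0 (z + 1) (by omega) (by omega) (by omega)) rfl))).symm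
  have hconst : ∀ z ≤ M₃, ∑ x ∈ Finset.range M₁, ∑ y ∈ Finset.range M₂, S z x y = 1 := by
    intro z
    induction z with
    | zero =>
      exact fun _ => sum_squareCochain_eq_one M₁ M₂ (fun x y => g x y 0)
        (fun x hx' y hy' => hz₀ _ (hbox x y 0 hx' hy' (Nat.zero_le _)) rfl)
        (fun y hy' => hx₀ _ (hbox 0 y 0 (Nat.zero_le _) hy' (Nat.zero_le _)) rfl)
        (fun y hy' => hx _ (hbox M₁ y 0 le_rfl hy' (Nat.zero_le _)) rfl)
        (fun x hx' => hy₀ _ (hbox x 0 0 hx' (Nat.zero_le _) (Nat.zero_le _)) rfl)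
        (fun x hx' => hy _ (hbox x M₂ 0 hx' le_rfl (Nat.zero_le _)) rfl)
    | succ z ih => exact fun hz' => (hslice z hz').symm.trans (ih (Nat.le_of_succ_le hz'))
  have htop : ∑ x ∈ Finset.range M₁, ∑ y ∈ Finset.range M₂, S M₃ x y = 0 := by
    refine Finset.sum_eq_zero fun x hx' => Finset.sum_eq_zero fun y hy' => ?_
    have hx' := Finset.mem_range.1 hx'
    have hy' := Finset.mem_range.1 hy'
    exact squareCochain_eq_zero_of_missing (i := 2) (by decide)
      (hz _ (hbox x y M₃ (by omega) (by omega) le_rfl) rfl)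
      (hz _ (hbox (x + 1) y M₃ (by omega) (by omega) le_rfl) rfl)
      (hz _ (hbox x (y + 1) M₃ (by omega) (by omega) le_rfl) rfl)
      (hz _ (hbox (x + 1) (y + 1) M₃ (by omega) (by omega) le_rfl) rfl)
  exact zero_ne_one (htop.symm.trans (hconst M₃ le_rfl))

/-- The index of the first negative coordinate, or `3` if there is none. -/
def firstNeg (v : ℤ × ℤ × ℤ) : Fin 4 :=
  if v.1 < 0 then 0 else if v.2.1 < 0 then 1 else if v.2.2 < 0 then 2 else 3

theorem firstNeg_eq_zero {v : ℤ × ℤ × ℤ} : firstNeg v = 0 ↔ v.1 < 0 := by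
  unfold firstNeg; split_ifs <;> simp_all

theorem firstNeg_le_one {v : ℤ × ℤ × ℤ} : firstNeg v ≤ 1 ↔ v.1 < 0 ∨ v.2.1 < 0 := by
  unfold firstNeg; split_ifs <;> simp_all

theorem firstNeg_le_two {v : ℤ × ℤ × ℤ} :
    firstNeg v ≤ 2 ↔ v.1 < 0 ∨ v.2.1 < 0 ∨ v.2.2 < 0 := by
  unfold firstNeg; split_ifs <;> simp_all

theorem snd_fst_neg_of_firstNeg_eq_one {v : ℤ × ℤ × ℤ} (h : firstNeg v = 1) : v.2.1 < 0 := by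
  unfold firstNeg at h; split_ifs at h <;> simp_all

theorem snd_snd_neg_of_firstNeg_eq_two {v : ℤ × ℤ × ℤ} (h : firstNeg v = 2) : v.2.2 < 0 := by
  unfold firstNeg at h; split_ifs at h <;> simp_all

theorem nonneg_of_firstNeg_eq_three {v : ℤ × ℤ × ℤ} (h : firstNeg v = 3) :
    0 ≤ v.1 ∧ 0 ≤ v.2.1 ∧ 0 ≤ v.2.2 := by
  unfold firstNeg at h; split_ifs at h <;> simp_all

theorem chebDist3_le_iff {p q : ℤ × ℤ × ℤ} {r : ℤ} : chebDist3 p q ≤ r ↔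
    |p.1 - q.1| ≤ r ∧ |p.2.1 - q.2.1| ≤ r ∧ |p.2.2 - q.2.2| ≤ r := by
  simp [chebDist3]

/-- Three-dimensional discrete covering lemma: a map of the discrete box to
`ℤ³` that moves adjacent points by at most `c` and is within `D` of the identity
on the boundary `3c`-covers every point whose distance to the boundary is at
least `D + 1`. -/
theorem discrete_covering_three (c D M₁ M₂ M₃ : ℕ)
    (hM₁ : 1 ≤ M₁) (hM₂ : 1 ≤ M₂) (hM₃ : 1 ≤ M₃)
    (f : ℤ × ℤ × ℤ → ℤ × ℤ × ℤ)
    (hstep : ∀ p ∈ Box3 M₁ M₂ M₃, ∀ p' ∈ Box3 M₁ M₂ M₃, Adj3 p p' →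
      chebDist3 (f p) (f p') ≤ (c : ℤ))
    (hbd : ∀ p ∈ Bdry3 M₁ M₂ M₃, chebDist3 (f p) p ≤ (D : ℤ))
    (q : ℤ × ℤ × ℤ) (hq : q ∈ Box3 M₁ M₂ M₃)
    (hqfar : ∀ p ∈ Bdry3 M₁ M₂ M₃, (D : ℤ) + 1 ≤ chebDist3 q p) :
    ∃ p ∈ Box3 M₁ M₂ M₃, chebDist3 (f p) q ≤ 3 * (c : ℤ) := by
  simp only [chebDist3_le_iff, abs_le] at hstep hbd
  obtain ⟨hq₁, hq₁', hq₂, hq₂', hq₃, hq₃'⟩ := hq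
  have far : ∀ p ∈ Bdry3 M₁ M₂ M₃, ¬ chebDist3 q p ≤ D := fun p hp h => by
    have := hqfar p hp
    omega
  simp only [chebDist3_le_iff] at far
  have far₁ : ∀ t : ℤ, t = 0 ∨ t = M₁ → (D : ℤ) < |q.1 - t| := fun t ht => by
    have := far (t, q.2.1, q.2.2) (by simp only [Bdry3, Box3, Set.mem_ofPred_eq]; omega)
    simpa using this
  have far₂ : ∀ t : ℤ, t = 0 ∨ t = M₂ → (D : ℤ) < |q.2.1 - t| := fun t ht => by
    have := far (q.1, t, q.2.2) (by simp only [Bdry3, Box3, Set.mem_ofPred_eq]; omega)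
    simpa using this
  have far₃ : ∀ t : ℤ, t = 0 ∨ t = M₃ → (D : ℤ) < |q.2.2 - t| := fun t ht => by
    have := far (q.1, q.2.1, t) (by simp only [Bdry3, Box3, Set.mem_ofPred_eq]; omega)
    simpa using this
  have low₁ := far₁ 0 (Or.inl rfl)
  have high₁ := far₁ M₁ (Or.inr rfl)
  have low₂ := far₂ 0 (Or.inl rfl)
  have high₂ := far₂ M₂ (Or.inr rfl)
  have low₃ := far₃ 0 (Or.inl rfl)
  have high₃ := far₃ M₃ (Or.inr rfl)
  rw [sub_zero, abs_of_nonneg hq₁] at low₁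
  rw [sub_zero, abs_of_nonneg hq₂] at low₂
  rw [sub_zero, abs_of_nonneg hq₃] at low₃
  rw [abs_sub_comm, abs_of_nonneg (by omega)] at high₁ high₂ high₃
  obtain ⟨a, ha, b, hb, c', hc, d, hd, hab, hbc, hcd, hall⟩ :=
    exists_fully_labelled_path M₁ M₂ M₃ (fun p => firstNeg (f p - q))
      (fun p hp h => firstNeg_eq_zero.2 (by
        have := hbd p ⟨hp, by tauto⟩
        simp only [Prod.fst_sub]
        omega))
      (fun p hp h => fun hl => by
        have := hbd p ⟨hp, by tauto⟩
        have := firstNeg_eq_zero.1 hl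
        simp only [Prod.fst_sub] at this
        omega)
      (fun p hp h => firstNeg_le_one.2 (Or.inr (by
        have := hbd p ⟨hp, by tauto⟩
        simp only [Prod.fst_sub, Prod.snd_sub]
        omega)))
      (fun p hp h => fun hl => by
        have := hbd p ⟨hp, by tauto⟩
        have := snd_fst_neg_of_firstNeg_eq_one hl
        simp only [Prod.fst_sub, Prod.snd_sub] at this
        omega)
      (fun p hp h => firstNeg_le_two.2 (Or.inr (Or.inr (by
        have := hbd p ⟨hp, by tauto⟩
        simp only [Prod.snd_sub]
        omega))))
      (fun p hp h => fun hl => by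
        have := hbd p ⟨hp, by tauto⟩
        have := snd_snd_neg_of_firstNeg_eq_two hl
        simp only [Prod.snd_sub] at this
        omega)
  have sab := hstep a ha b hb hab
  have sbc := hstep b hb c' hc hbc
  have scd := hstep c' hc d hd hcd
  have near : ∀ u, u = a ∨ u = b ∨ u = c' ∨ u = d → chebDist3 (f a) (f u) ≤ 3 * (c : ℤ) := by
    simp only [chebDist3_le_iff, abs_le]
    rintro u (rfl | rfl | rfl | rfl) <;> omega
  simp only [chebDist3_le_iff, abs_le] at near
  have exists_label : ∀ i : Fin 4, ∃ u, (u = a ∨ u = b ∨ u = c' ∨ u = d) ∧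
      firstNeg (f u - q) = i := fun i => by
    rcases hall i with h | h | h | h
    exacts [⟨a, by tauto, h⟩, ⟨b, by tauto, h⟩, ⟨c', by tauto, h⟩, ⟨d, by tauto, h⟩]
  obtain ⟨u₀, hu₀, l₀⟩ := exists_label 0
  obtain ⟨u₁, hu₁, l₁⟩ := exists_label 1
  obtain ⟨u₂, hu₂, l₂⟩ := exists_label 2
  obtain ⟨u₃, hu₃, l₃⟩ := exists_label 3
  have n₀ := near u₀ hu₀
  have n₁ := near u₁ hu₁
  have n₂ := near u₂ hu₂
  have n₃ := near u₃ hu₃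
  have s₀ := firstNeg_eq_zero.1 l₀
  have s₁ := snd_fst_neg_of_firstNeg_eq_one l₁
  have s₂ := snd_snd_neg_of_firstNeg_eq_two l₂
  have s₃ := nonneg_of_firstNeg_eq_three l₃
  simp only [Prod.fst_sub, Prod.snd_sub] at s₀ s₁ s₂ s₃
  refine ⟨a, ha, ?_⟩
  simp only [chebDist3_le_iff, abs_le]
  omega
end
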